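/- arXiv:2408.05611 — 2 statements merged into one kernel-verified Lean document; each statement's English description precedes it below -/
import Mathlib

section
/- Let D and D' be distinct central diagonals of a regular (2n+2)-gon, and let k_1 and k_2 be the number of sides of the polygon on each side of the quadrilateral spanned by the endpoints of D and D' (so k_1 + k_2 = n + 1, with k_1, k_2 >= 1). Then the number of edges of the type-B associahedron b_n joining the class Psi(D) to the class Psi(D') equals C_{k_1 - 1} * C_{k_2 - 1}, where C_m denotes the m-th Catalan number. -/
open scoped BigOperators

/-- `x` lies strictly inside the (clockwise) arc from `a` to `b` of the regular `m`-gon,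
whose vertices are labeled by `ZMod m`. -/
def arcMem (m : ℕ) (a b x : ZMod m) : Prop :=
  0 < (x - a).val ∧ (x - a).val < (b - a).val

/-- Ordered version of the crossing predicate for the chords `{a,b}` and `{c,d}`:
exactly one of `c, d` lies strictly inside the open arc from `a` to `b`. -/
def crossPairs (m : ℕ) (a b c d : ZMod m) : Prop :=
  (arcMem m a b c ∧ arcMem m b a d) ∨ (arcMem m a b d ∧ arcMem m b a c)

/-- Two chords of the convex `m`-gon cross (in their interiors). -/
def Crosses (m : ℕ) (e f : Sym2 (ZMod m)) : Prop :=
  ∃ a b c d : ZMod m, e = s(a, b) ∧ f = s(c, d) ∧ crossPairs m a b c d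

/-- `e` is a diagonal of the convex `m`-gon: its endpoints are distinct and non-adjacent. -/
def IsDiagonal (m : ℕ) (e : Sym2 (ZMod m)) : Prop :=
  ∃ a b : ZMod m, e = s(a, b) ∧ a ≠ b ∧ b ≠ a + 1 ∧ a ≠ b + 1

/-- A triangulation of the convex `m`-gon: a maximal set of pairwise non-crossing diagonals. -/
def IsTriangulation (m : ℕ) (T : Finset (Sym2 (ZMod m))) : Prop :=
  (∀ e ∈ T, IsDiagonal m e) ∧
  (∀ e ∈ T, ∀ f ∈ T, ¬ Crosses m e f) ∧
  (∀ e, IsDiagonal m e → e ∉ T → ∃ f ∈ T, Crosses m e f)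

/-- A diagonal of the regular `(2n+2)`-gon is central if it joins two opposite vertices,
i.e. passes through the center of the polygon. -/
def IsCentral (n : ℕ) (e : Sym2 (ZMod (2 * n + 2))) : Prop :=
  ∃ a : ZMod (2 * n + 2), e = s(a, a + (n : ZMod (2 * n + 2)) + 1)

/-- The central diagonal of the regular `(2n+2)`-gon with endpoint `a`. -/
def centralDiag (n : ℕ) (a : ZMod (2 * n + 2)) : Sym2 (ZMod (2 * n + 2)) :=
  s(a, a + (n : ZMod (2 * n + 2)) + 1)

/-- A centrally-symmetric triangulation of the regular `(2n+2)`-gon: a triangulation invariant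
under 180-degree rotation, i.e. under adding `n+1` to every vertex label. -/
def CSTriangulation (n : ℕ) (T : Finset (Sym2 (ZMod (2 * n + 2)))) : Prop :=
  IsTriangulation (2 * n + 2) T ∧
  ∀ e ∈ T, Sym2.map (· + ((n : ZMod (2 * n + 2)) + 1)) e ∈ T

/-- Two arcs `i < j` of a line cross: their endpoints strictly alternate. -/
def Interlace (p q : ℕ × ℕ) : Prop :=
  (p.1 < q.1 ∧ q.1 < p.2 ∧ p.2 < q.2) ∨ (q.1 < p.1 ∧ p.1 < q.2 ∧ q.2 < p.2)

/-- The arcs of length at least two with endpoints in `[i, j]`. -/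
def arcs (i j : ℕ) : Finset (ℕ × ℕ) :=
  (Finset.Icc i j ×ˢ Finset.Icc i j).filter fun p => p.1 + 2 ≤ p.2

lemma mem_arcs {i j : ℕ} {p : ℕ × ℕ} :
    p ∈ arcs i j ↔ i ≤ p.1 ∧ p.1 + 2 ≤ p.2 ∧ p.2 ≤ j := by
  simp only [arcs, Finset.mem_filter, Finset.mem_product, Finset.mem_Icc]
  omega

open Classical in
/-- The maximal noncrossing families of arcs in `[i, j]`, i.e. the triangulations of the convex
polygon with vertices `i, …, j` (the root side `(i, j)` being counted as a member). -/
noncomputable def maxArcs (i j : ℕ) : Finset (Finset (ℕ × ℕ)) :=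
  (arcs i j).powerset.filter fun U =>
    (∀ p ∈ U, ∀ q ∈ U, ¬ Interlace p q) ∧ ∀ p ∈ arcs i j, p ∉ U → ∃ q ∈ U, Interlace p q

lemma mem_maxArcs {i j : ℕ} {U : Finset (ℕ × ℕ)} :
    U ∈ maxArcs i j ↔ U ⊆ arcs i j ∧ (∀ p ∈ U, ∀ q ∈ U, ¬ Interlace p q) ∧
      ∀ p ∈ arcs i j, p ∉ U → ∃ q ∈ U, Interlace p q := by
  simp [maxArcs]

lemma root_mem_of_mem_maxArcs {i j : ℕ} {U : Finset (ℕ × ℕ)} (hU : U ∈ maxArcs i j)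
    (hij : i + 2 ≤ j) : (i, j) ∈ U := by
  obtain ⟨h1, -, h3⟩ := mem_maxArcs.1 hU
  by_contra hn
  obtain ⟨q, hq, hx⟩ := h3 (i, j) (mem_arcs.2 ⟨le_rfl, hij, le_rfl⟩) hn
  have := mem_arcs.1 (h1 hq)
  simp only [Interlace] at hx
  omega

/-- `z` is the apex of the triangle of `U` resting on the root side `(i, j)`: no other arc of `U`
passes over `z`. -/
def IsApex (i j z : ℕ) (U : Finset (ℕ × ℕ)) : Prop :=
  ∀ p ∈ U, p ≠ (i, j) → ¬ (p.1 < z ∧ z < p.2)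

lemma IsApex.mem_or {i j z : ℕ} {U : Finset (ℕ × ℕ)} (hU : U ⊆ arcs i j)
    (h : IsApex i j z U) {p : ℕ × ℕ} (hp : p ∈ U) (hne : p ≠ (i, j)) :
    p ∈ arcs i z ∨ p ∈ arcs z j := by
  have h1 := h p hp hne
  have h2 := mem_arcs.1 (hU hp)
  simp only [mem_arcs]
  omega

lemma insert_root_mem_maxArcs {i j z : ℕ} (hiz : i < z) (hzj : z < j) {U V : Finset (ℕ × ℕ)}
    (hU : U ∈ maxArcs i z) (hV : V ∈ maxArcs z j) :
    insert (i, j) (U ∪ V) ∈ maxArcs i j := by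
  have rU := root_mem_of_mem_maxArcs hU
  have rV := root_mem_of_mem_maxArcs hV
  obtain ⟨u1, u2, u3⟩ := mem_maxArcs.1 hU
  obtain ⟨v1, v2, v3⟩ := mem_maxArcs.1 hV
  have key : ∀ p ∈ insert (i, j) (U ∪ V), p = (i, j) ∨ (p ∈ U ∧ p ∈ arcs i z) ∨
      (p ∈ V ∧ p ∈ arcs z j) := by
    intro p hp
    simp only [Finset.mem_insert, Finset.mem_union] at hp
    rcases hp with h | h | h
    · exact Or.inl h
    · exact Or.inr (Or.inl ⟨h, u1 h⟩)
    · exact Or.inr (Or.inr ⟨h, v1 h⟩)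
  refine mem_maxArcs.2 ⟨?_, ?_, ?_⟩
  · intro p hp
    rcases key p hp with rfl | ⟨-, h⟩ | ⟨-, h⟩
    · simp only [mem_arcs]; omega
    · simp only [mem_arcs] at h ⊢; omega
    · simp only [mem_arcs] at h ⊢; omega
  · intro p hp q hq
    rcases key p hp with rfl | ⟨hp, h⟩ | ⟨hp, h⟩ <;>
      rcases key q hq with rfl | ⟨hq, h'⟩ | ⟨hq, h'⟩
    case inr.inl.inr.inl => exact u2 p hp q hq
    case inr.inr.inr.inr => exact v2 p hp q hq
    all_goals simp only [mem_arcs, Interlace] at *; omega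
  · rintro ⟨x, y⟩ hp hn
    simp only [Finset.mem_insert, Finset.mem_union, not_or, Prod.mk.injEq] at hn
    have hp' := mem_arcs.1 hp
    simp only at hp'
    by_cases hyz : y ≤ z
    · obtain ⟨q, hq, hx⟩ := u3 (x, y) (by simp only [mem_arcs]; omega) hn.2.1
      exact ⟨q, by simp [hq], hx⟩
    by_cases hzx : z ≤ x
    · obtain ⟨q, hq, hx⟩ := v3 (x, y) (by simp only [mem_arcs]; omega) hn.2.2
      exact ⟨q, by simp [hq], hx⟩
    by_cases hix : i < x
    · exact ⟨(i, z), by simp [rU (by omega)], by simp only [Interlace]; omega⟩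
    · exact ⟨(z, j), by simp [rV (by omega)], by simp only [Interlace]; omega⟩

lemma IsApex.inter_left_mem {i j z : ℕ} (hzj : z < j) {W : Finset (ℕ × ℕ)}
    (hW : W ∈ maxArcs i j) (h : IsApex i j z W) : W ∩ arcs i z ∈ maxArcs i z := by
  obtain ⟨w1, w2, w3⟩ := mem_maxArcs.1 hW
  refine mem_maxArcs.2 ⟨Finset.inter_subset_right, fun p hp q hq =>
    w2 p (Finset.mem_inter.1 hp).1 q (Finset.mem_inter.1 hq).1, fun p hp hn => ?_⟩
  have hp' := mem_arcs.1 hp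
  obtain ⟨q, hq, hx⟩ := w3 p (mem_arcs.2 (by omega)) fun hh => hn (Finset.mem_inter.2 ⟨hh, hp⟩)
  by_cases hqr : q = (i, j)
  · subst hqr; simp only [Interlace] at hx; omega
  rcases h.mem_or w1 hq hqr with h' | h'
  · exact ⟨q, Finset.mem_inter.2 ⟨hq, h'⟩, hx⟩
  · have := mem_arcs.1 h'
    simp only [Interlace] at hx; omega

lemma IsApex.inter_right_mem {i j z : ℕ} (hiz : i < z) {W : Finset (ℕ × ℕ)}
    (hW : W ∈ maxArcs i j) (h : IsApex i j z W) : W ∩ arcs z j ∈ maxArcs z j := by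
  obtain ⟨w1, w2, w3⟩ := mem_maxArcs.1 hW
  refine mem_maxArcs.2 ⟨Finset.inter_subset_right, fun p hp q hq =>
    w2 p (Finset.mem_inter.1 hp).1 q (Finset.mem_inter.1 hq).1, fun p hp hn => ?_⟩
  have hp' := mem_arcs.1 hp
  obtain ⟨q, hq, hx⟩ := w3 p (mem_arcs.2 (by omega)) fun hh => hn (Finset.mem_inter.2 ⟨hh, hp⟩)
  by_cases hqr : q = (i, j)
  · subst hqr; simp only [Interlace] at hx; omega
  rcases h.mem_or w1 hq hqr with h' | h'
  · have := mem_arcs.1 h'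
    simp only [Interlace] at hx; omega
  · exact ⟨q, Finset.mem_inter.2 ⟨hq, h'⟩, hx⟩

open Classical in
lemma card_filter_isApex {i j z : ℕ} (hiz : i < z) (hzj : z < j) :
    ((maxArcs i j).filter (IsApex i j z)).card = (maxArcs i z).card * (maxArcs z j).card := by
  rw [← Finset.card_product]
  refine Finset.card_nbij' (fun W => (W ∩ arcs i z, W ∩ arcs z j))
    (fun P => insert (i, j) (P.1 ∪ P.2)) ?_ ?_ ?_ ?_
  · intro W hW
    obtain ⟨hW, ha⟩ := Finset.mem_filter.1 hW
    exact Finset.mem_product.2 ⟨ha.inter_left_mem hzj hW, ha.inter_right_mem hiz hW⟩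
  · rintro ⟨U, V⟩ hP
    obtain ⟨hU, hV⟩ := Finset.mem_product.1 hP
    refine Finset.mem_filter.2 ⟨insert_root_mem_maxArcs hiz hzj hU hV, ?_⟩
    intro p hp hne
    simp only [Finset.mem_insert, hne, Finset.mem_union, false_or] at hp
    rcases hp with h | h
    · have := mem_arcs.1 ((mem_maxArcs.1 hU).1 h); omega
    · have := mem_arcs.1 ((mem_maxArcs.1 hV).1 h); omega
  · intro W hW
    obtain ⟨hW, ha⟩ := Finset.mem_filter.1 hW
    have hr := root_mem_of_mem_maxArcs hW (by omega)
    ext p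
    simp only [Finset.mem_insert, Finset.mem_union, Finset.mem_inter]
    constructor
    · rintro (rfl | h | h)
      exacts [hr, h.1, h.1]
    · intro hp
      by_cases hne : p = (i, j)
      · exact Or.inl hne
      · rcases ha.mem_or (mem_maxArcs.1 hW).1 hp hne with h | h
        exacts [Or.inr (Or.inl ⟨hp, h⟩), Or.inr (Or.inr ⟨hp, h⟩)]
  · rintro ⟨U, V⟩ hP
    obtain ⟨hU, hV⟩ := Finset.mem_product.1 hP
    have hU' := (mem_maxArcs.1 hU).1
    have hV' := (mem_maxArcs.1 hV).1
    refine Prod.ext ?_ ?_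
    · ext p
      simp only [Finset.mem_insert, Finset.mem_union, Finset.mem_inter]
      refine ⟨?_, fun h => ⟨Or.inr (Or.inl h), hU' h⟩⟩
      rintro ⟨rfl | h | h, h'⟩
      · simp only [mem_arcs] at h'; omega
      · exact h
      · have := mem_arcs.1 (hV' h)
        rw [mem_arcs] at h'; omega
    · ext p
      simp only [Finset.mem_insert, Finset.mem_union, Finset.mem_inter]
      refine ⟨?_, fun h => ⟨Or.inr (Or.inr h), hV' h⟩⟩
      rintro ⟨rfl | h | h, h'⟩
      · simp only [mem_arcs] at h'; omega
      · have := mem_arcs.1 (hU' h)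
        rw [mem_arcs] at h'; omega
      · exact h

lemma exists_isApex {i j : ℕ} (hij : i + 2 ≤ j) {U : Finset (ℕ × ℕ)} (hU : U ∈ maxArcs i j) :
    ∃ z, i < z ∧ z < j ∧ IsApex i j z U := by
  classical
  obtain ⟨h1, h2, -⟩ := mem_maxArcs.1 hU
  let S := (Finset.Ioo i j).filter fun z => z = i + 1 ∨ (i, z) ∈ U
  have hS : S.Nonempty := ⟨i + 1, by simp [S]; omega⟩
  obtain ⟨hz, hzU⟩ := Finset.mem_filter.1 (S.max'_mem hS)
  have hmax := S.le_max'
  set z := S.max' hS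
  rw [Finset.mem_Ioo] at hz
  refine ⟨z, hz.1, hz.2, ?_⟩
  rintro ⟨x, y⟩ hp hne hlt
  have hp' := mem_arcs.1 (h1 hp)
  simp only [ne_eq, Prod.mk.injEq] at hne hp' hlt
  rcases Nat.eq_or_lt_of_le hp'.1 with rfl | hix
  · have := hmax y (Finset.mem_filter.2 ⟨Finset.mem_Ioo.2 (by omega), Or.inr hp⟩)
    omega
  · rcases hzU with hzU | hzU
    · omega
    · exact h2 _ hzU _ hp (by simp only [Interlace]; omega)

lemma IsApex.not_lt {i j z w : ℕ} {U : Finset (ℕ × ℕ)} (hU : U ∈ maxArcs i j)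
    (hz : IsApex i j z U) (hw : IsApex i j w U) (hiz : i < z) (hwj : w < j) : ¬ z < w := by
  intro hzw
  obtain ⟨h1, -, h3⟩ := mem_maxArcs.1 hU
  by_cases hm : (z, j) ∈ U
  · exact hw _ hm (by simp; omega) ⟨hzw, hwj⟩
  · obtain ⟨q, hq, hx⟩ := h3 (z, j) (mem_arcs.2 (by simp only; omega)) hm
    have hq' := mem_arcs.1 (h1 hq)
    simp only [Interlace] at hx
    refine hz q hq ?_ (by omega)
    rintro rfl
    simp only at hx
    omega

lemma card_maxArcs (k : ℕ) : ∀ i, (maxArcs i (i + k + 1)).card = catalan k := by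
  classical
  induction k using Nat.strong_induction_on with
  | _ k ih =>
    intro i
    cases k with
    | zero =>
      have : arcs i (i + 0 + 1) = ∅ := by
        ext p; simp only [mem_arcs, Finset.notMem_empty, iff_false]; omega
      have : maxArcs i (i + 0 + 1) = {∅} := by
        ext U; simp +contextual [mem_maxArcs, this]
      simp [this]
    | succ k =>
      have hU : maxArcs i (i + (k + 1) + 1) = (Finset.univ : Finset (Fin k.succ)).biUnion
          fun t => (maxArcs i (i + (k + 1) + 1)).filter
            (IsApex i (i + (k + 1) + 1) (i + t + 1)) := by
        ext U
        simp only [Finset.mem_biUnion, Finset.mem_univ, true_and, Finset.mem_filter]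
        refine ⟨fun h => ?_, fun ⟨_, h, _⟩ => h⟩
        obtain ⟨z, hz1, hz2, hz⟩ := exists_isApex (by omega) h
        refine ⟨⟨z - i - 1, by omega⟩, h, ?_⟩
        have : i + (z - i - 1) + 1 = z := by omega
        simpa only [this] using hz
      rw [hU, Finset.card_biUnion, catalan_succ]
      · refine Finset.sum_congr rfl fun t _ => ?_
        have ht := t.2
        rw [card_filter_isApex (by omega) (by omega), ih t (by omega),
          show i + (k + 1) + 1 = (i + t + 1) + (k - t) + 1 by omega, ih (k - t) (by omega)]
      · intro s _ t _ hst
        refine Finset.disjoint_left.2 fun U hs ht => hst ?_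
        obtain ⟨hU, hs⟩ := Finset.mem_filter.1 hs
        obtain ⟨-, ht⟩ := Finset.mem_filter.1 ht
        have h1 := hs.not_lt hU ht (by omega) (by omega)
        have h2 := ht.not_lt hU hs (by omega) (by omega)
        ext; omega

/-- The chord of the `m`-gon joining the vertices `p.1` and `p.2` in the labelling that starts
at `a`. -/
def chord {m : ℕ} (a : ZMod m) (p : ℕ × ℕ) : Sym2 (ZMod m) := s(a + p.1, a + p.2)

lemma val_cast_sub_cast {m : ℕ} (a : ZMod m) {x u : ℕ} (hx : x < m) (hu : u < m) :
    ((a + u) - (a + x)).val = if x ≤ u then u - x else u + m - x := by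
  rw [add_sub_add_left_eq_sub]
  split_ifs with h
  · rw [← Nat.cast_sub h, ZMod.val_cast_of_lt (by omega)]
  · have : (u : ZMod m) - x = ((u + m - x : ℕ) : ZMod m) := by
      rw [Nat.cast_sub (by omega)]; simp
    rw [this, ZMod.val_cast_of_lt (by omega)]

lemma add_cast_inj {m : ℕ} (a : ZMod m) {x u : ℕ} (hx : x < m) (hu : u < m) :
    a + (x : ZMod m) = a + u ↔ x = u := by
  rw [add_right_inj, ZMod.natCast_eq_natCast_iff', Nat.mod_eq_of_lt hx, Nat.mod_eq_of_lt hu]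

lemma exists_add_cast {m : ℕ} [NeZero m] (a v : ZMod m) : ∃ x < m, v = a + (x : ℕ) :=
  ⟨(v - a).val, ZMod.val_lt _, by simp⟩

lemma crosses_chord {m : ℕ} (a : ZMod m) {p q : ℕ × ℕ} (hp : p.1 < p.2) (hp' : p.2 < m)
    (hq : q.1 < q.2) (hq' : q.2 < m) :
    Crosses m (chord a p) (chord a q) ↔ Interlace p q := by
  obtain ⟨x, y⟩ := p
  obtain ⟨u, v⟩ := q
  simp only at hp hp' hq hq'
  have hx : x < m := by omega
  have hu : u < m := by omega
  constructor
  · rintro ⟨b, c, d, e, h1, h2, h3⟩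
    simp only [chord, Sym2.eq_iff] at h1 h2
    simp only [Interlace]
    rcases h1 with ⟨rfl, rfl⟩ | ⟨rfl, rfl⟩ <;> rcases h2 with ⟨rfl, rfl⟩ | ⟨rfl, rfl⟩ <;>
      simp only [crossPairs, arcMem, val_cast_sub_cast a, hx, hp', hu, hq'] at h3 <;>
      split_ifs at h3 <;> omega
  · intro h
    refine ⟨_, _, _, _, rfl, rfl, ?_⟩
    simp only [Interlace] at h
    simp only [crossPairs, arcMem, val_cast_sub_cast a, hx, hp', hu, hq']
    split_ifs <;> omega

lemma chord_inj {m : ℕ} (a : ZMod m) {p q : ℕ × ℕ} (hp : p.1 < p.2) (hp' : p.2 < m)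
    (hq : q.1 < q.2) (hq' : q.2 < m) : chord a p = chord a q ↔ p = q := by
  rw [chord, chord, Sym2.eq_iff, add_cast_inj a (by omega) (by omega),
    add_cast_inj a (by omega) (by omega), add_cast_inj a (by omega) (by omega),
    add_cast_inj a (by omega) (by omega), Prod.ext_iff]
  omega

lemma add_cast_eq_succ {m : ℕ} (a : ZMod m) {x u : ℕ} (hx : x < m) (hu : u < m) :
    a + (x : ZMod m) = a + u + 1 ↔ x = u + 1 ∨ (x = 0 ∧ u + 1 = m) := by
  rcases Nat.lt_or_ge (u + 1) m with h | h
  · have : a + (u : ZMod m) + 1 = a + ((u + 1 : ℕ) : ZMod m) := by push_cast; ring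
    rw [this, add_cast_inj a hx h]
    omega
  · have h' : u + 1 = m := by omega
    have : a + (u : ZMod m) + 1 = a + ((0 : ℕ) : ZMod m) := by
      rw [add_assoc, ← Nat.cast_succ, Nat.succ_eq_add_one, h']; simp
    rw [this, add_cast_inj a hx (by omega)]
    omega

lemma isDiagonal_chord {m : ℕ} (a : ZMod m) {p : ℕ × ℕ} (hp : p.1 < p.2) (hp' : p.2 < m) :
    IsDiagonal m (chord a p) ↔ p.1 + 2 ≤ p.2 ∧ ¬ (p.1 = 0 ∧ p.2 + 1 = m) := by
  have hx : p.1 < m := by omega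
  constructor
  · rintro ⟨b, c, h, h1, h2, h3⟩
    rw [chord, Sym2.eq_iff] at h
    rcases h with ⟨rfl, rfl⟩ | ⟨rfl, rfl⟩ <;>
      rw [Ne, add_cast_eq_succ a (by omega) (by omega)] at h2 h3 <;> omega
  · intro h
    refine ⟨_, _, rfl, ?_, ?_, ?_⟩
    · rw [Ne, add_cast_inj a hx hp']; omega
    · rw [Ne, add_cast_eq_succ a hp' hx]; omega
    · rw [Ne, add_cast_eq_succ a hx hp']; omega

lemma IsDiagonal.exists_chord {m : ℕ} [NeZero m] (a : ZMod m) {e : Sym2 (ZMod m)}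
    (he : IsDiagonal m e) : ∃ p : ℕ × ℕ, p.1 + 2 ≤ p.2 ∧ p.2 < m ∧ ¬ (p.1 = 0 ∧ p.2 + 1 = m) ∧
      e = chord a p := by
  suffices h : ∃ p : ℕ × ℕ, p.1 < p.2 ∧ p.2 < m ∧ e = chord a p by
    obtain ⟨p, h1, h2, rfl⟩ := h
    have := (isDiagonal_chord a h1 h2).1 he
    exact ⟨p, this.1, h2, this.2, rfl⟩
  obtain ⟨b, c, rfl, hne, -, -⟩ := he
  obtain ⟨x, hx, rfl⟩ := exists_add_cast a b
  obtain ⟨y, hy, rfl⟩ := exists_add_cast a c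
  rw [Ne, add_cast_inj a hx hy] at hne
  rcases Nat.lt_or_gt_of_ne hne with h | h
  · exact ⟨(x, y), h, hy, rfl⟩
  · exact ⟨(y, x), h, hx, Sym2.eq_swap⟩

lemma Crosses.symm {m : ℕ} [NeZero m] {e f : Sym2 (ZMod m)} (he : IsDiagonal m e)
    (hf : IsDiagonal m f) (h : Crosses m e f) : Crosses m f e := by
  obtain ⟨p, hp, hp', -, rfl⟩ := he.exists_chord 0
  obtain ⟨q, hq, hq', -, rfl⟩ := hf.exists_chord 0
  rw [crosses_chord 0 (by omega) (by omega) (by omega) (by omega)] at h ⊢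
  exact Or.symm h

/-- Rotation of chords of the `(2n+2)`-gon by 180 degrees. -/
def rot (n : ℕ) (e : Sym2 (ZMod (2 * n + 2))) : Sym2 (ZMod (2 * n + 2)) :=
  Sym2.map (· + ((n : ZMod (2 * n + 2)) + 1)) e

lemma half_add_half (n : ℕ) : ((n : ZMod (2 * n + 2)) + 1) + (n + 1) = 0 := by
  have := ZMod.natCast_self (2 * n + 2)
  push_cast at this
  rw [← this]; ring

lemma rot_rot {n : ℕ} (e : Sym2 (ZMod (2 * n + 2))) : rot n (rot n e) = e := by
  induction e with
  | _ x y => simp only [rot, Sym2.map_mk, add_assoc x, add_assoc y, half_add_half, add_zero]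

lemma Crosses.rot {n : ℕ} {e f : Sym2 (ZMod (2 * n + 2))} (h : Crosses (2 * n + 2) e f) :
    Crosses (2 * n + 2) (rot n e) (rot n f) := by
  obtain ⟨a, b, c, d, rfl, rfl, h⟩ := h
  refine ⟨_, _, _, _, rfl, rfl, ?_⟩
  simpa only [crossPairs, arcMem, add_sub_add_right_eq_sub] using h

lemma IsDiagonal.rot {n : ℕ} {e : Sym2 (ZMod (2 * n + 2))} (h : IsDiagonal (2 * n + 2) e) :
    IsDiagonal (2 * n + 2) (rot n e) := by
  obtain ⟨a, b, rfl, h1, h2, h3⟩ := h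
  refine ⟨_, _, rfl, by simpa using h1, ?_, ?_⟩
  · rw [add_right_comm]; simpa using h2
  · rw [add_right_comm]; simpa using h3

lemma centralDiag_eq_chord (n : ℕ) (a : ZMod (2 * n + 2)) :
    centralDiag n a = chord a (0, n + 1) := by
  simp [centralDiag, chord, add_assoc]

lemma centralDiag_add_eq_chord (n k : ℕ) (a : ZMod (2 * n + 2)) :
    centralDiag n (a + k) = chord a (k, k + n + 1) := by
  simp [centralDiag, chord, add_assoc]

lemma centralDiag_add_half (n : ℕ) (a : ZMod (2 * n + 2)) :
    centralDiag n (a + (n + 1)) = centralDiag n a := by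
  rw [centralDiag, centralDiag, add_assoc a n 1, add_assoc (a + _) (n : ZMod _) 1, add_assoc a,
    half_add_half, add_zero, Sym2.eq_swap]

lemma rot_centralDiag (n : ℕ) (a : ZMod (2 * n + 2)) :
    rot n (centralDiag n a) = centralDiag n a := by
  rw [← centralDiag_add_half n a, centralDiag_add_half n a]
  conv_rhs => rw [← centralDiag_add_half n a]
  simp only [rot, centralDiag, Sym2.map_mk, add_assoc]

lemma rot_chord {n : ℕ} (a : ZMod (2 * n + 2)) (x y : ℕ) :
    rot n (chord a (x, y)) = chord a (x + n + 1, y + n + 1) := by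
  simp [rot, chord, add_assoc]

lemma rot_chord_half {n : ℕ} (a : ZMod (2 * n + 2)) (x : ℕ) :
    rot n (chord a (x, n + 1)) = chord a (0, x + n + 1) := by
  have h : a + ((n + 1 : ℕ) : ZMod (2 * n + 2)) + (n + 1) = a := by
    rw [add_assoc, Nat.cast_add, Nat.cast_one, half_add_half, add_zero]
  rw [chord, rot, Sym2.map_mk, h, chord, Sym2.eq_swap]
  simp [add_assoc]

lemma arcs_half_bounds {n : ℕ} {p : ℕ × ℕ} (hp : p ∈ arcs 0 (n + 1)) :
    p.1 + 2 ≤ p.2 ∧ p.2 ≤ n + 1 ∧ 1 ≤ n := by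
  have := mem_arcs.1 hp
  omega

lemma isDiagonal_of_mem_arcs {n : ℕ} (a : ZMod (2 * n + 2)) {p : ℕ × ℕ}
    (hp : p ∈ arcs 0 (n + 1)) : IsDiagonal (2 * n + 2) (chord a p) := by
  have := arcs_half_bounds hp
  rw [isDiagonal_chord a (by omega) (by omega)]
  omega

lemma isDiagonal_centralDiag {n : ℕ} (hn : 1 ≤ n) (a : ZMod (2 * n + 2)) :
    IsDiagonal (2 * n + 2) (centralDiag n a) := by
  rw [centralDiag_eq_chord]
  exact isDiagonal_of_mem_arcs a (mem_arcs.2 (by simp only; omega))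

lemma exists_rot_chord_eq {n : ℕ} (a : ZMod (2 * n + 2)) {p : ℕ × ℕ} (hp : p ∈ arcs 0 (n + 1)) :
    ∃ q : ℕ × ℕ, q.1 + 2 ≤ q.2 ∧ q.2 < 2 * n + 2 ∧
      (n + 1 ≤ q.1 ∨ q.1 = 0 ∧ n + 1 ≤ q.2) ∧ (q = (0, n + 1) → p = (0, n + 1)) ∧
      rot n (chord a p) = chord a q := by
  obtain ⟨x, y⟩ := p
  have := arcs_half_bounds hp
  simp only at this
  by_cases hy : y = n + 1
  · subst hy
    refine ⟨_, ?_, ?_, ?_, ?_, rot_chord_half a x⟩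
    · simp only; omega
    · simp only; omega
    · simp only [true_and]; omega
    · intro h
      simp only [Prod.mk.injEq, true_and, and_true] at h ⊢
      omega
  · refine ⟨_, ?_, ?_, ?_, ?_, rot_chord a x y⟩
    · simp only; omega
    · simp only; omega
    · simp only; omega
    · intro h
      simp only [Prod.mk.injEq] at h
      omega

lemma chord_eq_rot_chord {n : ℕ} (a : ZMod (2 * n + 2)) {p q : ℕ × ℕ} (hp : p ∈ arcs 0 (n + 1))
    (hq : q ∈ arcs 0 (n + 1)) (h : chord a p = rot n (chord a q)) :
    p = (0, n + 1) ∧ q = (0, n + 1) := by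
  obtain ⟨r, hr, hr', hr'', h0, he⟩ := exists_rot_chord_eq a hq
  have := arcs_half_bounds hp
  rw [he, chord_inj a (by omega) (by omega) (by omega) (by omega)] at h
  subst h
  have : p = (0, n + 1) := Prod.ext (by simp only; omega) (by simp only; omega)
  exact ⟨this, h0 this⟩

lemma not_crosses_rot_chord {n : ℕ} (a : ZMod (2 * n + 2)) {p q : ℕ × ℕ}
    (hp : p ∈ arcs 0 (n + 1)) (hq : q ∈ arcs 0 (n + 1)) :
    ¬ Crosses (2 * n + 2) (chord a p) (rot n (chord a q)) := by
  obtain ⟨r, hr, hr', hr'', -, he⟩ := exists_rot_chord_eq a hq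
  have := arcs_half_bounds hp
  rw [he, crosses_chord a (by omega) (by omega) (by omega) (by omega)]
  simp only [Interlace]
  omega

lemma exists_mem_arcs_of_not_crosses {n : ℕ} (a : ZMod (2 * n + 2)) {e : Sym2 (ZMod (2 * n + 2))}
    (he : IsDiagonal (2 * n + 2) e) (hc : ¬ Crosses (2 * n + 2) (centralDiag n a) e) :
    ∃ p ∈ arcs 0 (n + 1), e = chord a p ∨ e = rot n (chord a p) := by
  obtain ⟨⟨x, y⟩, h1, h2, h3, rfl⟩ := he.exists_chord a
  simp only at h1 h2 h3
  rw [centralDiag_eq_chord, crosses_chord a (by simp) (by simp only; omega) (by simp only; omega)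
    h2] at hc
  simp only [Interlace] at hc
  by_cases hy : y ≤ n + 1
  · exact ⟨(x, y), mem_arcs.2 (by simp only; omega), Or.inl rfl⟩
  by_cases hx : n + 1 ≤ x
  · refine ⟨(x - n - 1, y - n - 1), mem_arcs.2 (by simp only; omega), Or.inr ?_⟩
    rw [rot_chord]
    congr 2 <;> omega
  · refine ⟨(y - n - 1, n + 1), mem_arcs.2 (by simp only; omega), Or.inr ?_⟩
    rw [rot_chord_half]
    congr 2 <;> omega

lemma eq_centralDiag_of_rot_eq {n : ℕ} (a : ZMod (2 * n + 2)) {e : Sym2 (ZMod (2 * n + 2))}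
    (he : IsDiagonal (2 * n + 2) e) (hc : ¬ Crosses (2 * n + 2) (centralDiag n a) e)
    (hr : rot n e = e) : e = centralDiag n a := by
  obtain ⟨p, hp, rfl | rfl⟩ := exists_mem_arcs_of_not_crosses a he hc
  · rw [(chord_eq_rot_chord a hp hp hr.symm).1, centralDiag_eq_chord]
  · rw [rot_rot] at hr
    rw [← hr, (chord_eq_rot_chord a hp hp hr).1, centralDiag_eq_chord]

lemma CSTriangulation.rot_mem {n : ℕ} {T : Finset (Sym2 (ZMod (2 * n + 2)))}
    (hT : CSTriangulation n T) {e : Sym2 (ZMod (2 * n + 2))} (he : e ∈ T) : rot n e ∈ T :=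
  hT.2 e he

lemma CSTriangulation.rot_mem_iff {n : ℕ} {T : Finset (Sym2 (ZMod (2 * n + 2)))}
    (hT : CSTriangulation n T) {e : Sym2 (ZMod (2 * n + 2))} : rot n e ∈ T ↔ e ∈ T :=
  ⟨fun h => by simpa only [rot_rot] using hT.rot_mem h, hT.rot_mem⟩

open Classical in
/-- The arcs of `T` on one side of the central diagonal at `a` (which is included). -/
noncomputable def halfArcs (n : ℕ) (a : ZMod (2 * n + 2)) (T : Finset (Sym2 (ZMod (2 * n + 2)))) :
    Finset (ℕ × ℕ) :=
  (arcs 0 (n + 1)).filter fun p => chord a p ∈ T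

lemma mem_halfArcs {n : ℕ} {a : ZMod (2 * n + 2)} {T : Finset (Sym2 (ZMod (2 * n + 2)))}
    {p : ℕ × ℕ} : p ∈ halfArcs n a T ↔ p ∈ arcs 0 (n + 1) ∧ chord a p ∈ T := by
  simp [halfArcs]

lemma crosses_chord_of_mem_arcs {n : ℕ} (a : ZMod (2 * n + 2)) {p q : ℕ × ℕ}
    (hp : p ∈ arcs 0 (n + 1)) (hq : q ∈ arcs 0 (n + 1)) :
    Crosses (2 * n + 2) (chord a p) (chord a q) ↔ Interlace p q := by
  have := arcs_half_bounds hp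
  have := arcs_half_bounds hq
  exact crosses_chord a (by omega) (by omega) (by omega) (by omega)

lemma chord_inj_of_mem_arcs {n : ℕ} (a : ZMod (2 * n + 2)) {p q : ℕ × ℕ}
    (hp : p ∈ arcs 0 (n + 1)) (hq : q ∈ arcs 0 (n + 1)) : chord a p = chord a q ↔ p = q := by
  have := arcs_half_bounds hp
  have := arcs_half_bounds hq
  exact chord_inj a (by omega) (by omega) (by omega) (by omega)

lemma halfArcs_mem_maxArcs {n : ℕ} {a : ZMod (2 * n + 2)} {T : Finset (Sym2 (ZMod (2 * n + 2)))}
    (hT : CSTriangulation n T) (ha : centralDiag n a ∈ T) :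
    halfArcs n a T ∈ maxArcs 0 (n + 1) := by
  obtain ⟨t1, t2, t3⟩ := hT.1
  refine mem_maxArcs.2 ⟨fun p hp => (mem_halfArcs.1 hp).1, ?_, ?_⟩
  · intro p hp q hq hx
    rw [mem_halfArcs] at hp hq
    exact t2 _ hp.2 _ hq.2 ((crosses_chord_of_mem_arcs a hp.1 hq.1).2 hx)
  · intro p hp hn
    obtain ⟨f, hf, hx⟩ := t3 _ (isDiagonal_of_mem_arcs a hp) fun h => hn (mem_halfArcs.2 ⟨hp, h⟩)
    obtain ⟨q, hq, rfl | rfl⟩ := exists_mem_arcs_of_not_crosses a (t1 f hf) (t2 _ ha _ hf)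
    · exact ⟨q, mem_halfArcs.2 ⟨hq, hf⟩, (crosses_chord_of_mem_arcs a hp hq).1 hx⟩
    · exact absurd hx (not_crosses_rot_chord a hp hq)

lemma subset_of_halfArcs_eq {n : ℕ} {a : ZMod (2 * n + 2)}
    {T T' : Finset (Sym2 (ZMod (2 * n + 2)))} (hT : CSTriangulation n T)
    (hT' : CSTriangulation n T') (ha : centralDiag n a ∈ T)
    (h : halfArcs n a T = halfArcs n a T') : T ⊆ T' := by
  intro f hf
  have key : ∀ p ∈ arcs 0 (n + 1), chord a p ∈ T → chord a p ∈ T' := fun p hp hpT =>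
    (mem_halfArcs.1 (h ▸ mem_halfArcs.2 ⟨hp, hpT⟩)).2
  obtain ⟨p, hp, rfl | rfl⟩ :=
    exists_mem_arcs_of_not_crosses a (hT.1.1 f hf) (hT.1.2.1 _ ha _ hf)
  · exact key p hp hf
  · exact hT'.rot_mem (key p hp (hT.rot_mem_iff.1 hf))

open Classical in
/-- The centrally symmetric family of chords generated by a family of arcs on one side of the
central diagonal at `a`. -/
noncomputable def symmetrize (n : ℕ) (a : ZMod (2 * n + 2)) (U : Finset (ℕ × ℕ)) :
    Finset (Sym2 (ZMod (2 * n + 2))) :=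
  U.image (chord a) ∪ U.image fun p => rot n (chord a p)

lemma mem_symmetrize {n : ℕ} {a : ZMod (2 * n + 2)} {U : Finset (ℕ × ℕ)}
    {e : Sym2 (ZMod (2 * n + 2))} :
    e ∈ symmetrize n a U ↔ ∃ p ∈ U, e = chord a p ∨ e = rot n (chord a p) := by
  simp only [symmetrize, Finset.mem_union, Finset.mem_image, eq_comm (a := e), ← exists_or,
    and_or_left]

lemma centralDiag_mem_symmetrize {n : ℕ} (hn : 1 ≤ n) (a : ZMod (2 * n + 2))
    {U : Finset (ℕ × ℕ)} (hU : U ∈ maxArcs 0 (n + 1)) : centralDiag n a ∈ symmetrize n a U :=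
  mem_symmetrize.2 ⟨_, root_mem_of_mem_maxArcs hU (by omega),
    Or.inl (centralDiag_eq_chord n a)⟩

lemma halfArcs_symmetrize {n : ℕ} (a : ZMod (2 * n + 2)) {U : Finset (ℕ × ℕ)}
    (hU : U ⊆ arcs 0 (n + 1)) : halfArcs n a (symmetrize n a U) = U := by
  ext p
  rw [mem_halfArcs, mem_symmetrize]
  refine ⟨?_, fun h => ⟨hU h, p, h, Or.inl rfl⟩⟩
  rintro ⟨hp, q, hq, h | h⟩
  · rwa [(chord_inj_of_mem_arcs a hp (hU hq)).1 h]
  · obtain ⟨rfl, rfl⟩ := chord_eq_rot_chord a hp (hU hq) h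
    exact hq

lemma csTriangulation_symmetrize {n : ℕ} (hn : 1 ≤ n) (a : ZMod (2 * n + 2))
    {U : Finset (ℕ × ℕ)} (hU : U ∈ maxArcs 0 (n + 1)) :
    CSTriangulation n (symmetrize n a U) := by
  obtain ⟨u1, u2, u3⟩ := mem_maxArcs.1 hU
  have hrot : ∀ e ∈ symmetrize n a U, rot n e ∈ symmetrize n a U := by
    intro e he
    obtain ⟨p, hp, rfl | rfl⟩ := mem_symmetrize.1 he
    · exact mem_symmetrize.2 ⟨p, hp, Or.inr rfl⟩
    · exact mem_symmetrize.2 ⟨p, hp, Or.inl (rot_rot _)⟩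
  refine ⟨⟨?_, ?_, ?_⟩, hrot⟩
  · intro e he
    obtain ⟨p, hp, rfl | rfl⟩ := mem_symmetrize.1 he
    exacts [isDiagonal_of_mem_arcs a (u1 hp), (isDiagonal_of_mem_arcs a (u1 hp)).rot]
  · have key : ∀ p ∈ U, ∀ f ∈ symmetrize n a U, ¬ Crosses (2 * n + 2) (chord a p) f := by
      intro p hp f hf
      obtain ⟨q, hq, rfl | rfl⟩ := mem_symmetrize.1 hf
      · rw [crosses_chord_of_mem_arcs a (u1 hp) (u1 hq)]
        exact u2 p hp q hq
      · exact not_crosses_rot_chord a (u1 hp) (u1 hq)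
    intro e he f hf hx
    obtain ⟨p, hp, rfl | rfl⟩ := mem_symmetrize.1 he
    · exact key p hp f hf hx
    · have := hx.rot
      rw [rot_rot] at this
      exact key p hp _ (hrot f hf) this
  · intro e he hn'
    by_cases hc : Crosses (2 * n + 2) (centralDiag n a) e
    · exact ⟨_, centralDiag_mem_symmetrize hn a hU, hc.symm (isDiagonal_centralDiag hn a) he⟩
    have key : ∀ p ∈ arcs 0 (n + 1), p ∉ U → ∃ q ∈ U,
        Crosses (2 * n + 2) (chord a p) (chord a q) := by
      intro p hp hpU
      obtain ⟨q, hq, hx⟩ := u3 p hp hpU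
      exact ⟨q, hq, (crosses_chord_of_mem_arcs a hp (u1 hq)).2 hx⟩
    obtain ⟨p, hp, h⟩ := exists_mem_arcs_of_not_crosses a he hc
    obtain ⟨q, hq, hx⟩ := key p hp fun hpU => hn' (mem_symmetrize.2 ⟨p, hpU, h⟩)
    rcases h with rfl | rfl
    · exact ⟨_, mem_symmetrize.2 ⟨q, hq, Or.inl rfl⟩, hx⟩
    · exact ⟨_, mem_symmetrize.2 ⟨q, hq, Or.inr rfl⟩, hx.rot⟩

lemma crosses_centralDiag {n k : ℕ} (h1 : 1 ≤ k) (hk : k ≤ n) (a : ZMod (2 * n + 2)) :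
    Crosses (2 * n + 2) (centralDiag n a) (centralDiag n (a + k)) := by
  rw [centralDiag_eq_chord, centralDiag_add_eq_chord,
    crosses_chord a (by simp) (by simp only; omega) (by simp only; omega) (by simp only; omega)]
  simp only [Interlace]
  omega

lemma mem_of_forall_crosses {m : ℕ} {T : Finset (Sym2 (ZMod m))} (hT : IsTriangulation m T)
    {g : Sym2 (ZMod m)} (hg : IsDiagonal m g) (h : ∀ f ∈ T, ¬ Crosses m g f) : g ∈ T := by
  by_contra hn
  obtain ⟨f, hf, hx⟩ := hT.2.2 g hg hn
  exact h f hf hx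

/-- Flipping a central diagonal which is the only member crossed by another central diagonal. -/
lemma CSTriangulation.flip {n k : ℕ} (h1 : 1 ≤ k) (hk : k ≤ n) {a : ZMod (2 * n + 2)}
    {T : Finset (Sym2 (ZMod (2 * n + 2)))} (hT : CSTriangulation n T)
    (ha : centralDiag n a ∈ T)
    (hf : ∀ f ∈ T, f ≠ centralDiag n a → ¬ Crosses (2 * n + 2) (centralDiag n (a + k)) f) :
    CSTriangulation n (insert (centralDiag n (a + k)) (T.erase (centralDiag n a))) := by
  obtain ⟨t1, t2, t3⟩ := hT.1
  have hn : 1 ≤ n := h1.trans hk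
  have hD := isDiagonal_centralDiag hn a
  have hD' := isDiagonal_centralDiag hn (a + k)
  have hself : ¬ Crosses (2 * n + 2) (centralDiag n (a + k)) (centralDiag n (a + k)) := by
    rw [centralDiag_add_eq_chord, crosses_chord a (by simp only; omega) (by simp only; omega)
      (by simp only; omega) (by simp only; omega)]
    simp only [Interlace]
    omega
  refine ⟨⟨?_, ?_, ?_⟩, ?_⟩
  · intro e he
    rcases Finset.mem_insert.1 he with rfl | he
    exacts [hD', t1 e (Finset.mem_of_mem_erase he)]
  · intro e he f hf'
    rcases Finset.mem_insert.1 he with rfl | he <;> rcases Finset.mem_insert.1 hf' with rfl | hf'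
    · exact hself
    · exact hf f (Finset.mem_of_mem_erase hf') (Finset.ne_of_mem_erase hf')
    · exact fun hx => hf e (Finset.mem_of_mem_erase he) (Finset.ne_of_mem_erase he)
        (hx.symm (t1 e (Finset.mem_of_mem_erase he)) hD')
    · exact t2 e (Finset.mem_of_mem_erase he) f (Finset.mem_of_mem_erase hf')
  · intro e he hnot
    by_contra! hno
    have hne' : e ≠ centralDiag n (a + k) := fun h => hnot (by simp [h])
    have hxe' : ¬ Crosses (2 * n + 2) e (centralDiag n (a + k)) := hno _ (by simp)
    have hno' : ∀ f ∈ T, f ≠ centralDiag n a → ¬ Crosses (2 * n + 2) e f := fun f hfT hfn =>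
      hno f (by simp [hfT, hfn])
    have hne : e ≠ centralDiag n a := by
      rintro rfl
      exact hxe' (crosses_centralDiag h1 hk a)
    have heT : e ∉ T := fun h => hnot (by simp [h, hne])
    have hxe : Crosses (2 * n + 2) e (centralDiag n a) := by
      obtain ⟨f, hfT, hx⟩ := t3 e he heT
      by_cases h : f = centralDiag n a
      · rwa [← h]
      · exact absurd hx (hno' f hfT h)
    have side : ∀ x y : ℕ, x + 2 ≤ y → y < 2 * n + 2 → ¬ (x = 0 ∧ y + 1 = 2 * n + 2) →
        (x = 0 ∧ y = k ∨ x = k ∧ y = n + 1 ∨ x = n + 1 ∧ y = n + 1 + k ∨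
          x = 0 ∧ y = n + 1 + k) → ¬ Crosses (2 * n + 2) e (chord a (x, y)) := by
      intro x y hxy hy hedge hcase
      have hg : IsDiagonal (2 * n + 2) (chord a (x, y)) := by
        rw [isDiagonal_chord a (by simp only; omega) (by simpa using hy)]
        simp only
        omega
      have hgn : chord a (x, y) ≠ centralDiag n a := by
        rw [centralDiag_eq_chord, Ne, chord_inj a (by simp only; omega) (by simpa using hy)
          (by simp) (by simp only; omega), Prod.mk.injEq]
        omega
      refine hno' _ (mem_of_forall_crosses hT.1 hg fun f hfT hx => ?_) hgn
      have hfD := t2 _ ha f hfT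
      have hfD' : f ≠ centralDiag n a → _ := hf f hfT
      obtain ⟨⟨u, v⟩, u1, u2, u3, rfl⟩ := (t1 f hfT).exists_chord a
      simp only at u1 u2 u3
      rw [crosses_chord a (by simp only; omega) (by simpa using hy) (by simp only; omega)
        (by simpa using u2)] at hx
      rw [centralDiag_eq_chord, crosses_chord a (by simp) (by simp only; omega)
        (by simp only; omega) (by simpa using u2)] at hfD
      rw [centralDiag_eq_chord, centralDiag_add_eq_chord, Ne, chord_inj a (by simp only; omega)
        (by simpa using u2) (by simp) (by simp only; omega), crosses_chord a (by simp only; omega)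
        (by simp only; omega) (by simp only; omega) (by simpa using u2), Prod.mk.injEq] at hfD'
      simp only [Interlace] at hx hfD hfD'
      omega
    obtain ⟨⟨u, v⟩, u1, u2, u3, rfl⟩ := he.exists_chord a
    simp only at u1 u2 u3
    rw [centralDiag_eq_chord, crosses_chord a (by simp only; omega) (by simpa using u2) (by simp)
      (by simp only; omega)] at hxe
    rw [centralDiag_add_eq_chord, crosses_chord a (by simp only; omega) (by simpa using u2)
      (by simp only; omega) (by simp only; omega)] at hxe'
    rw [centralDiag_add_eq_chord, Ne, chord_inj a (by simp only; omega) (by simpa using u2)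
      (by simp only; omega) (by simp only; omega), Prod.mk.injEq] at hne'
    have side' : ∀ x y : ℕ, x + 2 ≤ y → y < 2 * n + 2 → ¬ (x = 0 ∧ y + 1 = 2 * n + 2) →
        (x = 0 ∧ y = k ∨ x = k ∧ y = n + 1 ∨ x = n + 1 ∧ y = n + 1 + k ∨
          x = 0 ∧ y = n + 1 + k) → ¬ Interlace (u, v) (x, y) := by
      intro x y hxy hy hedge hcase
      rw [← crosses_chord a (by simp only; omega) (by simpa using u2) (by simp only; omega)
        (by simpa using hy)]
      exact side x y hxy hy hedge hcase
    have s1 := fun h : 2 ≤ k => side' 0 k (by omega) (by omega) (by omega) (by omega)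
    have s2 := fun h : k + 1 ≤ n =>
      side' k (n + 1) (by omega) (by omega) (by omega) (by omega)
    have s3 := fun h : 2 ≤ k =>
      side' (n + 1) (n + 1 + k) (by omega) (by omega) (by omega) (by omega)
    have s4 := fun h : k + 1 ≤ n =>
      side' 0 (n + 1 + k) (by omega) (by omega) (by omega) (by omega)
    simp only [Interlace] at hxe hxe' s1 s2 s3 s4
    omega
  · intro e he
    change rot n e ∈ _
    rcases Finset.mem_insert.1 he with rfl | he
    · simp [rot_centralDiag]
    · refine Finset.mem_insert_of_mem (Finset.mem_erase.2 ⟨fun h => ?_,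
        hT.rot_mem (Finset.mem_of_mem_erase he)⟩)
      refine Finset.ne_of_mem_erase he ?_
      rw [← rot_rot e, h, rot_centralDiag]

lemma sdiff_eq_of_card_le_two {n : ℕ} {a : ZMod (2 * n + 2)}
    {T T' : Finset (Sym2 (ZMod (2 * n + 2)))} (hT : CSTriangulation n T)
    (hT' : CSTriangulation n T') (ha : centralDiag n a ∈ T) (ha' : centralDiag n a ∉ T')
    (hc : (T \ T').card ≤ 2) : T \ T' = {centralDiag n a} := by
  ext e
  rw [Finset.mem_singleton]
  refine ⟨fun he => ?_, fun h => by simp [h, ha, ha']⟩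
  by_contra hne
  obtain ⟨heT, heT'⟩ := Finset.mem_sdiff.1 he
  have h1 : rot n e ≠ e := fun h =>
    hne (eq_centralDiag_of_rot_eq a (hT.1.1 e heT) (hT.1.2.1 _ ha e heT) h)
  have h2 : rot n e ≠ centralDiag n a := fun h => hne (by rw [← rot_rot e, h, rot_centralDiag])
  have hsub : {centralDiag n a, e, rot n e} ⊆ T \ T' := by
    intro f hf
    simp only [Finset.mem_insert, Finset.mem_singleton] at hf
    rcases hf with rfl | rfl | rfl
    · simp [ha, ha']
    · exact he
    · simp [hT.rot_mem_iff, hT'.rot_mem_iff, heT, heT']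
  have := Finset.card_le_card hsub
  rw [Finset.card_eq_three.2 ⟨_, _, _, Ne.symm hne, h2.symm, h1.symm, rfl⟩] at this
  omega

lemma eq_insert_erase_of_card_sdiff_le_two {n k : ℕ} (h1 : 1 ≤ k) (hk : k ≤ n)
    {a : ZMod (2 * n + 2)} {T T' : Finset (Sym2 (ZMod (2 * n + 2)))} (hT : CSTriangulation n T)
    (hT' : CSTriangulation n T') (ha : centralDiag n a ∈ T)
    (ha' : centralDiag n (a + k) ∈ T') (hc : (T \ T').card ≤ 2) (hc' : (T' \ T).card ≤ 2) :
    T' = insert (centralDiag n (a + k)) (T.erase (centralDiag n a)) := by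
  have hx := crosses_centralDiag h1 hk a
  have e1 := sdiff_eq_of_card_le_two hT hT' ha (fun h => hT'.1.2.1 _ h _ ha' hx) hc
  have e2 := sdiff_eq_of_card_le_two hT' hT ha' (fun h => hT.1.2.1 _ ha _ h hx) hc'
  ext f
  have f1 := congrArg (f ∈ ·) e1
  have f2 := congrArg (f ∈ ·) e2
  simp only [Finset.mem_sdiff, Finset.mem_singleton, eq_iff_iff] at f1 f2
  simp only [Finset.mem_insert, Finset.mem_erase]
  tauto

lemma isApex_halfArcs {n k : ℕ} (hk : k ≤ n) {a : ZMod (2 * n + 2)}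
    {T : Finset (Sym2 (ZMod (2 * n + 2)))}
    (hf : ∀ f ∈ T, f ≠ centralDiag n a → ¬ Crosses (2 * n + 2) (centralDiag n (a + k)) f) :
    IsApex 0 (n + 1) k (halfArcs n a T) := by
  intro p hp hne hlt
  obtain ⟨hp, hpT⟩ := mem_halfArcs.1 hp
  have hb := arcs_half_bounds hp
  refine hf _ hpT ?_ ?_
  · rwa [centralDiag_eq_chord, Ne,
      chord_inj_of_mem_arcs a hp (mem_arcs.2 (by simp only; omega))]
  · rw [centralDiag_add_eq_chord, crosses_chord a (by simp only; omega) (by simp only; omega)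
      (by omega) (by omega)]
    simp only [Interlace]
    omega

lemma IsApex.not_crosses_symmetrize {n k : ℕ} (hk : k ≤ n) {a : ZMod (2 * n + 2)}
    {U : Finset (ℕ × ℕ)} (hU : U ⊆ arcs 0 (n + 1)) (h : IsApex 0 (n + 1) k U) :
    ∀ f ∈ symmetrize n a U, f ≠ centralDiag n a →
      ¬ Crosses (2 * n + 2) (centralDiag n (a + k)) f := by
  have key : ∀ p ∈ U, p ≠ (0, n + 1) →
      ¬ Crosses (2 * n + 2) (centralDiag n (a + k)) (chord a p) := by
    intro p hp hne
    have hb := arcs_half_bounds (hU hp)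
    have := h p hp hne
    rw [centralDiag_add_eq_chord, crosses_chord a (by simp only; omega) (by simp only; omega)
      (by omega) (by omega)]
    simp only [Interlace]
    omega
  intro f hf hne hx
  obtain ⟨p, hp, rfl | rfl⟩ := mem_symmetrize.1 hf
  · refine key p hp ?_ hx
    rintro rfl
    exact hne (centralDiag_eq_chord n a).symm
  · have hx' := hx.rot
    rw [rot_centralDiag, rot_rot] at hx'
    refine key p hp ?_ hx'
    rintro rfl
    exact hne (by rw [← centralDiag_eq_chord, rot_centralDiag])

/-- Let `D = centralDiag n a` and `D' = centralDiag n (a + k₁)` be distinct central diagonals of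
the regular `(2n+2)`-gon, so that the quadrilateral spanned by their endpoints has `k₁` polygon
sides on one side and `k₂ = n + 1 - k₁` on the other.  Then the number of edges of the type-B
associahedron joining `Ψ(D)` to `Ψ(D')` (counted here as pairs of centrally symmetric
triangulations, one containing `D`, the other `D'`, that differ by a flip) is
`C_{k₁-1} · C_{k₂-1}`. -/
theorem typeB_class_boundary_card (n k₁ k₂ : ℕ) (h1 : 1 ≤ k₁) (h2 : 1 ≤ k₂)
    (hsum : k₁ + k₂ = n + 1) (a : ZMod (2 * n + 2)) :
    Nat.card {p : Finset (Sym2 (ZMod (2 * n + 2))) × Finset (Sym2 (ZMod (2 * n + 2))) //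
        CSTriangulation n p.1 ∧ CSTriangulation n p.2 ∧
        centralDiag n a ∈ p.1 ∧ centralDiag n (a + (k₁ : ZMod (2 * n + 2))) ∈ p.2 ∧
        p.1 ≠ p.2 ∧ (p.1 \ p.2).card ≤ 2 ∧ (p.2 \ p.1).card ≤ 2} =
      catalan (k₁ - 1) * catalan (k₂ - 1) := by
  classical
  have hk : k₁ ≤ n := by omega
  have hn : 1 ≤ n := by omega
  have hcard : ((maxArcs 0 (n + 1)).filter (IsApex 0 (n + 1) k₁)).card =
      catalan (k₁ - 1) * catalan (k₂ - 1) := by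
    have e1 := card_maxArcs (k₁ - 1) 0
    have e2 := card_maxArcs (k₂ - 1) k₁
    rw [show 0 + (k₁ - 1) + 1 = k₁ by omega] at e1
    rw [show k₁ + (k₂ - 1) + 1 = n + 1 by omega] at e2
    rw [card_filter_isApex (by omega) (by omega), e1, e2]
  have hx := crosses_centralDiag h1 hk a
  rw [← hcard, ← Fintype.card_coe, ← Nat.card_eq_fintype_card]
  have happ : ∀ T T' : Finset (Sym2 (ZMod (2 * n + 2))), CSTriangulation n T →
      CSTriangulation n T' → centralDiag n a ∈ T → centralDiag n (a + k₁) ∈ T' →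
      (T \ T').card ≤ 2 → (T' \ T).card ≤ 2 →
      halfArcs n a T ∈ (maxArcs 0 (n + 1)).filter (IsApex 0 (n + 1) k₁) := by
    intro T T' hT hT' ha ha' hc hc'
    refine Finset.mem_filter.2 ⟨halfArcs_mem_maxArcs hT ha, isApex_halfArcs hk ?_⟩
    have he := eq_insert_erase_of_card_sdiff_le_two h1 hk hT hT' ha ha' hc hc'
    intro f hf hne
    exact hT'.1.2.1 _ ha' f (by rw [he]; simp [hf, hne])
  refine Nat.card_eq_of_bijective (fun p => ⟨halfArcs n a p.1.1, happ p.1.1 p.1.2 p.2.1 p.2.2.1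
    p.2.2.2.1 p.2.2.2.2.1 p.2.2.2.2.2.2.1 p.2.2.2.2.2.2.2⟩) ⟨?_, ?_⟩
  · rintro ⟨⟨T, T'⟩, hT, hT', ha, ha', _, hc, hc'⟩ ⟨⟨R, R'⟩, hR, hR', hb, hb', _, hd, hd'⟩ h
    have h : halfArcs n a T = halfArcs n a R := congrArg Subtype.val h
    obtain rfl : T = R := (subset_of_halfArcs_eq hT hR ha h).antisymm
      (subset_of_halfArcs_eq hR hT hb h.symm)
    obtain rfl : T' = R' :=
      (eq_insert_erase_of_card_sdiff_le_two h1 hk hT hT' ha ha' hc hc').trans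
        (eq_insert_erase_of_card_sdiff_le_two h1 hk hR hR' hb hb' hd hd').symm
    rfl
  · rintro ⟨U, hU⟩
    obtain ⟨hU, hap⟩ := Finset.mem_filter.1 hU
    have hUs := (mem_maxArcs.1 hU).1
    have hT := csTriangulation_symmetrize hn a hU
    have ha := centralDiag_mem_symmetrize hn a hU
    have hne : centralDiag n a ≠ centralDiag n (a + k₁) := fun h =>
      hT.1.2.1 _ ha _ ha (by rw [← h] at hx; exact hx)
    refine ⟨⟨(symmetrize n a U, insert (centralDiag n (a + k₁))
      ((symmetrize n a U).erase (centralDiag n a))), hT,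
      hT.flip h1 hk ha (hap.not_crosses_symmetrize hk hUs), ha, by simp, ?_, ?_, ?_⟩,
      Subtype.ext (halfArcs_symmetrize a hUs)⟩
    · intro h
      simp only at h
      rw [h] at ha
      simp [hne] at ha
    · refine (Finset.card_le_card (t := {centralDiag n a}) fun f hf => ?_).trans (by simp)
      simp only [Finset.mem_sdiff, Finset.mem_insert, Finset.mem_erase] at hf
      rw [Finset.mem_singleton]
      tauto
    · refine (Finset.card_le_card (t := {centralDiag n (a + k₁)}) fun f hf => ?_).trans (by simp)
      simp only [Finset.mem_sdiff, Finset.mem_insert, Finset.mem_erase] at hf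
      rw [Finset.mem_singleton]
      tauto
end

section
/- Let G = (V, E) be a finite connected graph with maximum degree Delta, and suppose h(G) >= eta > 0. Then for fixed epsilon in (0,1), the mixing time tau(epsilon) of the lazy simple random walk on G satisfies tau(epsilon) <= C * Delta^2 * log(|V|/epsilon) / eta^2 for a universal constant C. -/
open scoped BigOperators

/-- The number of edges of `G` with exactly one endpoint in `S`. -/
noncomputable def boundarySize {V : Type*} (G : SimpleGraph V) (S : Set V) : ℕ :=
  {e ∈ G.edgeSet | ∃ u ∈ e, u ∈ S ∧ ∃ v ∈ e, v ∉ S}.ncard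

/-- The (edge) expansion of `G`: the minimum of `|∂S|/|S|` over nonempty vertex
subsets `S` with `|S| ≤ |V|/2`. -/
noncomputable def expansion {V : Type*} (G : SimpleGraph V) : ℝ :=
  sInf {x : ℝ | ∃ S : Set V, S.Nonempty ∧ 2 * S.ncard ≤ Nat.card V ∧
    x = (boundarySize G S : ℝ) / (S.ncard : ℝ)}

/-- One step of the lazy simple random walk on `G`: stay put with probability `1/2`, otherwise
move to a uniformly random neighbor. -/
noncomputable def lazyStep {V : Type*} [Fintype V] (G : SimpleGraph V) [DecidableRel G.Adj]
    (μ : V → ℝ) : V → ℝ :=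
  fun v => μ v / 2 + ∑ u : V, if G.Adj u v then μ u / (2 * (G.degree u : ℝ)) else 0

/-- The stationary distribution of the lazy simple random walk on `G`: proportional to degrees. -/
noncomputable def statDist {V : Type*} [Fintype V] (G : SimpleGraph V) [DecidableRel G.Adj] :
    V → ℝ :=
  fun v => (G.degree v : ℝ) / ∑ u : V, (G.degree u : ℝ)

/-- Total variation distance between two distributions on a finite set. -/
noncomputable def tvDist {V : Type*} [Fintype V] (μ ν : V → ℝ) : ℝ :=
  (∑ v : V, |μ v - ν v|) / 2

section WeightedGraph

variable {V : Type*} [Fintype V] {w : V → V → ℝ}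

/-- Every real function on a finite nonempty type has a median. -/
theorem exists_median [Nonempty V] (f : V → ℝ) :
    ∃ m : ℝ, 2 * (Finset.univ.filter fun x => m < f x).card ≤ Fintype.card V ∧
      2 * (Finset.univ.filter fun x => f x < m).card ≤ Fintype.card V := by
  classical
  let A : Finset V := Finset.univ.filter fun x =>
    2 * (Finset.univ.filter fun y => f x < f y).card ≤ Fintype.card V
  have hA : A.Nonempty := by
    obtain ⟨x, -, hx⟩ := Finset.exists_max_image Finset.univ f Finset.univ_nonempty
    refine ⟨x, ?_⟩
    have : (Finset.univ.filter fun y => f x < f y) = ∅ := by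
      apply Finset.filter_eq_empty_iff.2
      intro y hy
      exact not_lt.2 (hx y hy)
    simp [A, this]
  obtain ⟨x, hxA, hx⟩ := Finset.exists_min_image A f hA
  refine ⟨f x, (Finset.mem_filter.1 hxA).2, ?_⟩
  rcases (Finset.univ.filter fun y => f y < f x).eq_empty_or_nonempty with h | h
  · simp [h]
  · obtain ⟨z, hz, hzmax⟩ := Finset.exists_max_image _ f h
    have hzx : f z < f x := (Finset.mem_filter.1 hz).2
    have hzA : z ∉ A := fun h => absurd (hx z h) (not_le.2 hzx)
    have hz2 : Fintype.card V < 2 * (Finset.univ.filter fun y => f z < f y).card := by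
      simpa [A] using hzA
    have hdisj : Disjoint (Finset.univ.filter fun y => f z < f y)
        (Finset.univ.filter fun y => f y < f x) := by
      rw [Finset.disjoint_left]
      intro y hy hy'
      exact absurd (hzmax y hy') (not_le.2 (Finset.mem_filter.1 hy).2)
    have := Finset.card_le_univ ((Finset.univ.filter fun y => f z < f y) ∪
        (Finset.univ.filter fun y => f y < f x))
    rw [Finset.card_union_of_disjoint hdisj] at this
    omega

/-- Expansion of the square sums of `f x + f y` in terms of the weighted degrees. -/
theorem sum_weight_mul_add_sq (hsymm : ∀ x y, w x y = w y x) (f : V → ℝ) :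
    ∑ x, ∑ y, w x y * (f x + f y) ^ 2 =
      4 * ∑ x, (∑ y, w x y) * f x ^ 2 - ∑ x, ∑ y, w x y * (f x - f y) ^ 2 := by
  have h1 : ∑ x, (∑ y, w x y) * f x ^ 2 = ∑ x, ∑ y, w x y * f x ^ 2 := by
    simp only [Finset.sum_mul]
  have h2 : ∑ x, (∑ y, w x y) * f x ^ 2 = ∑ x, ∑ y, w x y * f y ^ 2 := by
    rw [h1, Finset.sum_comm]
    simp only [hsymm]
  have h3 : ∑ x, ∑ y, w x y * (f x + f y) ^ 2 = ∑ x, ∑ y, (2 * (w x y * f x ^ 2) +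
      2 * (w x y * f y ^ 2) - w x y * (f x - f y) ^ 2) :=
    Finset.sum_congr rfl fun x _ => Finset.sum_congr rfl fun y _ => by ring
  rw [h3]
  simp only [Finset.sum_sub_distrib, Finset.sum_add_distrib, ← Finset.mul_sum]
  linarith

/-- The lazy averaging operator of a weighted graph. -/
noncomputable def lazyAverage (w : V → V → ℝ) (f : V → ℝ) : V → ℝ :=
  fun x => f x / 2 + (∑ y, w x y * f y) / (2 * ∑ y, w x y)

/-- One step of the lazy averaging operator decreases the weighted `L²` norm by at least a
multiple of the Dirichlet form. -/
theorem sum_sq_lazyAverage_le (hw : ∀ x y, 0 ≤ w x y) (hsymm : ∀ x y, w x y = w y x)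
    (hd : ∀ x, 0 < ∑ y, w x y) (f : V → ℝ) :
    ∑ x, (∑ y, w x y) * lazyAverage w f x ^ 2 ≤
      ∑ x, (∑ y, w x y) * f x ^ 2 - (∑ x, ∑ y, w x y * (f x - f y) ^ 2) / 4 := by
  have h := sum_weight_mul_add_sq hsymm f
  suffices hx : ∀ x, (∑ y, w x y) * lazyAverage w f x ^ 2 ≤
      (∑ y, w x y * (f x + f y) ^ 2) / 4 by
    have h' := Finset.sum_le_sum fun x (_ : x ∈ Finset.univ) => hx x
    rw [← Finset.sum_div] at h'
    linarith
  intro x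
  rw [lazyAverage]
  have hcs := Finset.sum_mul_sq_le_sq_mul_sq Finset.univ (fun y => √(w x y))
    (fun y => √(w x y) * (f x + f y))
  simp only [mul_pow, Real.sq_sqrt (hw _ _), ← mul_assoc, Real.mul_self_sqrt (hw _ _)] at hcs
  have hs : ∑ y, w x y * (f x + f y) = (∑ y, w x y) * f x + ∑ y, w x y * f y := by
    simp only [mul_add, Finset.sum_add_distrib, Finset.sum_mul]
  rw [hs] at hcs
  have hdx := hd x
  set d := ∑ y, w x y
  have : d * (f x / 2 + (∑ y, w x y * f y) / (2 * d)) ^ 2 =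
      (d * f x + ∑ y, w x y * f y) ^ 2 / (4 * d) := by
    field_simp
    ring
  rw [this, div_le_div_iff₀ (by positivity) (by norm_num)]
  nlinarith

/-- The lazy averaging operator preserves the weighted mean. -/
theorem sum_lazyAverage (hsymm : ∀ x y, w x y = w y x) (hd : ∀ x, 0 < ∑ y, w x y)
    (f : V → ℝ) :
    ∑ x, (∑ y, w x y) * lazyAverage w f x = ∑ x, (∑ y, w x y) * f x := by
  have h : ∀ x, (∑ y, w x y) * lazyAverage w f x =
      (∑ y, w x y) * f x / 2 + (∑ y, w x y * f y) / 2 := by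
    intro x
    have := (hd x).ne'
    rw [lazyAverage]
    field_simp
  have hswap : ∑ x, ∑ y, w x y * f y = ∑ x, (∑ y, w x y) * f x := by
    rw [Finset.sum_comm]
    simp only [Finset.sum_mul, hsymm]
  simp only [h, Finset.sum_add_distrib, ← Finset.sum_div]
  rw [hswap]
  ring

variable [DecidableEq V]

/-- Co-area inequality: an isoperimetric inequality for sets of at most half the vertices yields
an `L¹` Poincaré inequality for nonnegative functions supported on such sets. -/
theorem coarea_of_isoperimetry (hsymm : ∀ x y, w x y = w y x) {η : ℝ}
    (hiso : ∀ S : Finset V, 2 * S.card ≤ Fintype.card V →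
      η * S.card ≤ ∑ x, ∑ y, if x ∈ S ∧ y ∉ S then w x y else 0)
    (k : ℕ) (φ : V → ℝ) (hφ : ∀ x, 0 ≤ φ x)
    (hk : (Finset.univ.filter fun x => 0 < φ x).card = k) (hsupp : 2 * k ≤ Fintype.card V) :
    2 * η * ∑ x, φ x ≤ ∑ x, ∑ y, w x y * |φ x - φ y| := by
  induction k using Nat.strong_induction_on generalizing φ with
  | _ k ih =>
  set S := Finset.univ.filter fun x => 0 < φ x with hS
  have hmem : ∀ x, x ∈ S ↔ 0 < φ x := fun x => by simp [S]
  rcases S.eq_empty_or_nonempty with h | h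
  · have h0 : ∀ x, φ x = 0 := fun x => by
      refine le_antisymm (not_lt.1 fun hx => ?_) (hφ x)
      have := (hmem x).2 hx
      simp [h] at this
    simp [h0]
  · obtain ⟨z, hzS, hz⟩ := Finset.exists_min_image S φ h
    have hc : 0 < φ z := (hmem z).1 hzS
    set c := φ z
    let ψ : V → ℝ := fun x => φ x - if x ∈ S then c else 0
    have hout : ∀ x, x ∉ S → φ x = 0 := fun x hx =>
      le_antisymm (not_lt.1 fun h => hx ((hmem x).2 h)) (hφ x)
    have hψ : ∀ x, 0 ≤ ψ x := by
      intro x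
      by_cases hx : x ∈ S
      · simpa [ψ, hx] using hz x hx
      · simpa [ψ, hx] using hφ x
    have hlt : (Finset.univ.filter fun x => 0 < ψ x).card < k := by
      rw [← hk]
      apply Finset.card_lt_card
      rw [Finset.ssubset_iff_of_subset]
      · exact ⟨z, hzS, by simp [ψ, hzS, c]⟩
      · intro x hx
        by_contra hxS
        simp [ψ, hxS, hout x hxS] at hx
    have key := ih _ hlt ψ hψ rfl (by omega)
    have hb := hiso S (by omega)
    have hsum : ∑ x, φ x = ∑ x, ψ x + c * S.card := by
      simp [ψ, Finset.sum_sub_distrib, mul_comm]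
    have hpt : ∀ x y, w x y * |φ x - φ y| = w x y * |ψ x - ψ y| +
        (c * (if x ∈ S ∧ y ∉ S then w x y else 0) +
          c * (if y ∈ S ∧ x ∉ S then w y x else 0)) := by
      intro x y
      by_cases hx : x ∈ S <;> by_cases hy : y ∈ S
      · simp [ψ, hx, hy]
      · have h1 := hz x hx
        simp only [ψ, hx, hy, hout y hy, sub_zero, if_true, if_false, not_false_eq_true,
          and_self, not_true_eq_false]
        rw [abs_of_nonneg (hφ x), abs_of_nonneg (by linarith)]
        simp
        ring
      · have h1 := hz y hy
        simp only [ψ, hx, hy, hout x hx, zero_sub, sub_zero, if_true, if_false,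
          not_false_eq_true, and_self, not_true_eq_false, abs_neg]
        rw [abs_of_nonneg (hφ y), abs_of_nonneg (by linarith), hsymm x y]
        simp
        ring
      · simp [ψ, hx, hy]
    have hE : ∑ x, ∑ y, w x y * |φ x - φ y| = ∑ x, ∑ y, w x y * |ψ x - ψ y| +
        2 * (c * ∑ x, ∑ y, if x ∈ S ∧ y ∉ S then w x y else 0) := by
      simp only [hpt, Finset.sum_add_distrib, ← Finset.mul_sum]
      rw [Finset.sum_comm (f := fun x y => if y ∈ S ∧ x ∉ S then w y x else 0)]
      ring
    rw [hE, hsum]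
    nlinarith [mul_le_mul_of_nonneg_left hb hc.le]

/-- Cheeger's inequality for nonnegative functions supported on at most half the vertices. -/
theorem cheeger_of_small_support (hw : ∀ x y, 0 ≤ w x y) (hsymm : ∀ x y, w x y = w y x)
    {η D : ℝ} (hη : 0 < η) (hD : ∀ x, ∑ y, w x y ≤ D)
    (hiso : ∀ S : Finset V, 2 * S.card ≤ Fintype.card V →
      η * S.card ≤ ∑ x, ∑ y, if x ∈ S ∧ y ∉ S then w x y else 0)
    (g : V → ℝ) (hg : ∀ x, 0 ≤ g x)
    (hsupp : 2 * (Finset.univ.filter fun x => 0 < g x).card ≤ Fintype.card V) :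
    η ^ 2 * ∑ x, g x ^ 2 ≤ D * ∑ x, ∑ y, w x y * (g x - g y) ^ 2 := by
  set N := ∑ x, g x ^ 2 with hN
  set E := ∑ x, ∑ y, w x y * (g x - g y) ^ 2 with hE
  have hN0 : 0 ≤ N := Finset.sum_nonneg fun x _ => sq_nonneg _
  have hE0 : 0 ≤ E := Finset.sum_nonneg fun x _ => Finset.sum_nonneg fun y _ =>
    mul_nonneg (hw x y) (sq_nonneg _)
  have hfilter : (Finset.univ.filter fun x => 0 < g x ^ 2) =
      Finset.univ.filter fun x => 0 < g x := by
    ext x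
    simp [sq_pos_iff, (hg x).lt_iff_ne, eq_comm]
  have h1 := coarea_of_isoperimetry hsymm hiso _ (fun x => g x ^ 2) (fun x => sq_nonneg _)
    rfl (by rw [hfilter]; exact hsupp)
  set F := ∑ x, ∑ y, w x y * (g x + g y) ^ 2 with hF
  have hF4 : F ≤ 4 * (D * N) := by
    rw [hF, sum_weight_mul_add_sq hsymm]
    have : ∑ x, (∑ y, w x y) * g x ^ 2 ≤ ∑ x, D * g x ^ 2 :=
      Finset.sum_le_sum fun x _ => mul_le_mul_of_nonneg_right (hD x) (sq_nonneg _)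
    rw [← Finset.mul_sum] at this
    linarith
  have h2 : (∑ x, ∑ y, w x y * |g x ^ 2 - g y ^ 2|) ^ 2 ≤ E * F := by
    have := Finset.sum_mul_sq_le_sq_mul_sq (Finset.univ : Finset (V × V))
      (fun p => √(w p.1 p.2) * |g p.1 - g p.2|) (fun p => √(w p.1 p.2) * (g p.1 + g p.2))
    simp only [mul_pow, Real.sq_sqrt (hw _ _), sq_abs, Fintype.sum_prod_type] at this
    have heq : ∀ x y, w x y * |g x ^ 2 - g y ^ 2| =
        √(w x y) * |g x - g y| * (√(w x y) * (g x + g y)) := by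
      intro x y
      rw [sq_sub_sq, abs_mul, abs_of_nonneg (add_nonneg (hg x) (hg y)), mul_mul_mul_comm,
        Real.mul_self_sqrt (hw _ _), mul_comm (g x + g y)]
    simpa only [heq] using this
  rcases hN0.eq_or_lt with h0 | hpos
  · rw [← h0, mul_zero]
    rcases isEmpty_or_nonempty V with hV | ⟨⟨x⟩⟩
    · simp [hE]
    · exact mul_nonneg ((Finset.sum_nonneg fun y _ => hw x y).trans (hD x)) hE0
  · have h3 : (2 * η * N) ^ 2 ≤ E * (4 * (D * N)) :=
      (pow_le_pow_left₀ (by positivity) h1 2).trans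
        (h2.trans (mul_le_mul_of_nonneg_left hF4 hE0))
    refine le_of_mul_le_mul_right ?_ hpos
    linarith

/-- Cheeger's inequality for functions of weighted mean zero. -/
theorem cheeger_of_mean_zero [Nonempty V] (hw : ∀ x y, 0 ≤ w x y)
    (hsymm : ∀ x y, w x y = w y x)
    {η D : ℝ} (hη : 0 < η) (hD : ∀ x, ∑ y, w x y ≤ D)
    (hiso : ∀ S : Finset V, 2 * S.card ≤ Fintype.card V →
      η * S.card ≤ ∑ x, ∑ y, if x ∈ S ∧ y ∉ S then w x y else 0)
    (f : V → ℝ) (hf : ∑ x, (∑ y, w x y) * f x = 0) :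
    η ^ 2 * ∑ x, (∑ y, w x y) * f x ^ 2 ≤
      D ^ 2 * ∑ x, ∑ y, w x y * (f x - f y) ^ 2 := by
  obtain ⟨m, hm1, hm2⟩ := exists_median f
  have hd0 : ∀ x, 0 ≤ ∑ y, w x y := fun x => Finset.sum_nonneg fun y _ => hw x y
  have hD0 : 0 ≤ D := (hd0 (Classical.arbitrary V)).trans (hD _)
  have hp := cheeger_of_small_support hw hsymm hη hD hiso (fun x => max (f x - m) 0)
    (fun x => le_max_right _ _) (by simpa using hm1)
  have hn := cheeger_of_small_support hw hsymm hη hD hiso (fun x => max (m - f x) 0)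
    (fun x => le_max_right _ _) (by simpa using hm2)
  have hsq : ∑ x, (f x - m) ^ 2 =
      ∑ x, max (f x - m) 0 ^ 2 + ∑ x, max (m - f x) 0 ^ 2 := by
    rw [← Finset.sum_add_distrib]
    refine Finset.sum_congr rfl fun x _ => ?_
    rcases le_total (f x) m with h | h
    · rw [max_eq_right (by linarith), max_eq_left (by linarith)]; ring
    · rw [max_eq_left (by linarith), max_eq_right (by linarith)]; ring
  have hE : ∑ x, ∑ y, w x y * (max (f x - m) 0 - max (f y - m) 0) ^ 2 +
      ∑ x, ∑ y, w x y * (max (m - f x) 0 - max (m - f y) 0) ^ 2 ≤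
      ∑ x, ∑ y, w x y * (f x - f y) ^ 2 := by
    rw [← Finset.sum_add_distrib]
    refine Finset.sum_le_sum fun x _ => ?_
    rw [← Finset.sum_add_distrib]
    refine Finset.sum_le_sum fun y _ => ?_
    rw [← mul_add]
    refine mul_le_mul_of_nonneg_left ?_ (hw x y)
    rcases le_total (f x) m with hx | hx <;> rcases le_total (f y) m with hy | hy
    · rw [max_eq_right (by linarith), max_eq_right (by linarith), max_eq_left (by linarith),
        max_eq_left (by linarith)]
      nlinarith
    · rw [max_eq_right (by linarith), max_eq_left (by linarith), max_eq_left (by linarith),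
        max_eq_right (by linarith)]
      nlinarith [mul_nonneg (sub_nonneg.2 hx) (sub_nonneg.2 hy)]
    · rw [max_eq_left (by linarith), max_eq_right (by linarith), max_eq_right (by linarith),
        max_eq_left (by linarith)]
      nlinarith [mul_nonneg (sub_nonneg.2 hx) (sub_nonneg.2 hy)]
    · rw [max_eq_left (by linarith), max_eq_left (by linarith), max_eq_right (by linarith),
        max_eq_right (by linarith)]
      nlinarith
  have hmean : ∑ x, (∑ y, w x y) * f x ^ 2 ≤ ∑ x, (∑ y, w x y) * (f x - m) ^ 2 := by
    have h : ∑ x, (∑ y, w x y) * (f x - m) ^ 2 = ∑ x, (∑ y, w x y) * f x ^ 2 -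
        2 * m * ∑ x, (∑ y, w x y) * f x + ∑ x, (∑ y, w x y) * m ^ 2 := by
      rw [Finset.mul_sum, ← Finset.sum_sub_distrib, ← Finset.sum_add_distrib]
      exact Finset.sum_congr rfl fun x _ => by ring
    rw [h, hf]
    have : 0 ≤ ∑ x, (∑ y, w x y) * m ^ 2 :=
      Finset.sum_nonneg fun x _ => mul_nonneg (hd0 x) (sq_nonneg _)
    linarith
  have hdeg : ∑ x, (∑ y, w x y) * (f x - m) ^ 2 ≤ D * ∑ x, (f x - m) ^ 2 := by
    rw [Finset.mul_sum]
    exact Finset.sum_le_sum fun x _ => mul_le_mul_of_nonneg_right (hD x) (sq_nonneg _)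
  calc η ^ 2 * ∑ x, (∑ y, w x y) * f x ^ 2
      ≤ η ^ 2 * (D * ∑ x, (f x - m) ^ 2) :=
        mul_le_mul_of_nonneg_left (hmean.trans hdeg) (sq_nonneg _)
    _ = D * (η ^ 2 * ∑ x, (f x - m) ^ 2) := by ring
    _ ≤ D * (D * ∑ x, ∑ y, w x y * (f x - f y) ^ 2) := by
        refine mul_le_mul_of_nonneg_left ?_ hD0
        rw [hsq, mul_add]
        refine (add_le_add hp hn).trans ?_
        rw [← mul_add]
        exact mul_le_mul_of_nonneg_left hE hD0
    _ = _ := by ring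

/-- Exponential decay of the weighted `L²` norm of mean zero functions under lazy averaging. -/
theorem sum_sq_iterate_lazyAverage_le [Nonempty V] (hw : ∀ x y, 0 ≤ w x y)
    (hsymm : ∀ x y, w x y = w y x) (hd : ∀ x, 0 < ∑ y, w x y)
    {η D : ℝ} (hη : 0 < η) (hD : ∀ x, ∑ y, w x y ≤ D)
    (hiso : ∀ S : Finset V, 2 * S.card ≤ Fintype.card V →
      η * S.card ≤ ∑ x, ∑ y, if x ∈ S ∧ y ∉ S then w x y else 0)
    (f : V → ℝ) (hf : ∑ x, (∑ y, w x y) * f x = 0) (t : ℕ) :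
    ∑ x, (∑ y, w x y) * (lazyAverage w)^[t] f x ^ 2 ≤
      Real.exp (-(t * (η ^ 2 / (4 * D ^ 2)))) * ∑ x, (∑ y, w x y) * f x ^ 2 := by
  have hD0 : 0 < D := (hd (Classical.arbitrary V)).trans_le (hD _)
  have hmean : ∀ t : ℕ, ∑ x, (∑ y, w x y) * (lazyAverage w)^[t] f x = 0 := by
    intro t
    induction t with
    | zero => exact hf
    | succ t ih => simp only [Function.iterate_succ_apply', sum_lazyAverage hsymm hd, ih]
  induction t with
  | zero => simp
  | succ t ih =>
    rw [Function.iterate_succ_apply']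
    have h1 := sum_sq_lazyAverage_le hw hsymm hd ((lazyAverage w)^[t] f)
    have h2 := cheeger_of_mean_zero hw hsymm hη hD hiso _ (hmean t)
    have h0 : 0 ≤ ∑ x, (∑ y, w x y) * (lazyAverage w)^[t] f x ^ 2 :=
      Finset.sum_nonneg fun x _ => mul_nonneg (hd x).le (sq_nonneg _)
    set g := (lazyAverage w)^[t] f
    set r := η ^ 2 / (4 * D ^ 2) with hr
    set N := ∑ x, (∑ y, w x y) * g x ^ 2
    have h3 : r * N ≤ (∑ x, ∑ y, w x y * (g x - g y) ^ 2) / 4 := by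
      rw [hr, div_mul_eq_mul_div, div_le_div_iff₀ (by positivity) (by norm_num)]
      linarith
    have hexp : 1 - r ≤ Real.exp (-r) := by linarith [Real.add_one_le_exp (-r)]
    calc _ ≤ (1 - r) * N := by linarith
      _ ≤ Real.exp (-r) * N := mul_le_mul_of_nonneg_right hexp h0
      _ ≤ Real.exp (-r) * (Real.exp (-(t * r)) * ∑ x, (∑ y, w x y) * f x ^ 2) :=
        mul_le_mul_of_nonneg_left ih (Real.exp_pos _).le
      _ = _ := by
        rw [← mul_assoc, ← Real.exp_add]
        congr 2
        push_cast
        ring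

end WeightedGraph

section Graph

variable {V : Type*} [Fintype V] (G : SimpleGraph V) [DecidableRel G.Adj]

theorem sum_adj_eq_degree (x : V) :
    ∑ y, (if G.Adj x y then (1 : ℝ) else 0) = G.degree x := by
  rw [Finset.sum_boole, ← G.card_neighborFinset_eq_degree, G.neighborFinset_eq_filter]

/-- A lower bound on the expansion gives an isoperimetric inequality for the adjacency weights. -/
theorem isoperimetry_of_le_expansion [DecidableEq V] {η : ℝ} (hη : η ≤ expansion G)
    (S : Finset V) (hS : 2 * S.card ≤ Fintype.card V) :
    η * S.card ≤ ∑ x, ∑ y, if x ∈ S ∧ y ∉ S then (if G.Adj x y then (1 : ℝ) else 0) else 0 := by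
  rcases S.eq_empty_or_nonempty with rfl | hne
  · simp
  have hle : expansion G ≤ (boundarySize G (S : Set V) : ℝ) / S.card := by
    refine csInf_le ⟨0, ?_⟩ ⟨S, by simpa using hne, ?_, ?_⟩
    · rintro _ ⟨T, -, -, rfl⟩
      positivity
    · rwa [Set.ncard_coe_finset, Nat.card_eq_fintype_card]
    · rw [Set.ncard_coe_finset]
  have hc : (0 : ℝ) < S.card := by exact_mod_cast hne.card_pos
  have h1 : η * S.card ≤ boundarySize G (S : Set V) := (le_div_iff₀ hc).1 (hη.trans hle)
  let B : Finset (V × V) :=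
    Finset.univ.filter fun p => (p.1 ∈ S ∧ p.2 ∉ S) ∧ G.Adj p.1 p.2
  have h2 : boundarySize G (S : Set V) ≤ B.card := by
    rw [boundarySize]
    refine (Set.ncard_le_ncard (t := (B.image fun p => s(p.1, p.2) : Finset (Sym2 V))) ?_
      (Finset.finite_toSet _)).trans ?_
    · rintro e ⟨he, u, hu, huS, v, hv, hvS⟩
      have huv : u ≠ v := fun h => hvS (h ▸ huS)
      have heq : e = s(u, v) := (Sym2.mem_and_mem_iff huv).1 ⟨hu, hv⟩
      subst heq
      simp only [Finset.coe_image, Set.mem_image, Finset.mem_coe]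
      exact ⟨(u, v), by simpa [B] using ⟨⟨huS, hvS⟩, he⟩, rfl⟩
    · rw [Set.ncard_coe_finset]
      exact Finset.card_image_le
  have h3 : (∑ x, ∑ y, if x ∈ S ∧ y ∉ S then (if G.Adj x y then (1 : ℝ) else 0) else 0) =
      B.card := by
    rw [← Fintype.sum_prod_type' (f := fun x y =>
      if x ∈ S ∧ y ∉ S then (if G.Adj x y then (1 : ℝ) else 0) else 0)]
    simp only [← ite_and]
    rw [Finset.sum_boole]
  rw [h3]
  exact h1.trans (by exact_mod_cast h2)

/-- The density of a distribution with respect to the stationary measure evolves under the lazy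
walk by lazy averaging. -/
theorem lazyStep_div_degree (hd : ∀ x, 0 < G.degree x) (μ : V → ℝ) (c : ℝ) :
    (fun v => lazyStep G μ v / G.degree v - c) =
      lazyAverage (fun x y => if G.Adj x y then (1 : ℝ) else 0)
        (fun v => μ v / G.degree v - c) := by
  funext v
  have hv : (G.degree v : ℝ) ≠ 0 := by exact_mod_cast (hd v).ne'
  have h1 : ∑ u, (if G.Adj v u then (1 : ℝ) else 0) * (μ u / G.degree u - c) =
      2 * (∑ u, if G.Adj u v then μ u / (2 * (G.degree u : ℝ)) else 0) - G.degree v * c := by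
    rw [← sum_adj_eq_degree, Finset.sum_mul, Finset.mul_sum, ← Finset.sum_sub_distrib]
    refine Finset.sum_congr rfl fun u _ => ?_
    have hu : (G.degree u : ℝ) ≠ 0 := by exact_mod_cast (hd u).ne'
    simp only [G.adj_comm u v]
    split_ifs
    · field_simp
    · simp
  rw [lazyAverage, lazyStep, h1, sum_adj_eq_degree]
  field_simp
  ring

/-- Total variation to the stationary distribution is bounded through the weighted `L²` norm of
the centered density. -/
theorem sq_two_mul_tvDist_statDist_le (hd : ∀ x, 0 < G.degree x) (μ : V → ℝ) :
    (2 * tvDist μ (statDist G)) ^ 2 ≤ (∑ u, (G.degree u : ℝ)) *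
      ∑ v, (G.degree v : ℝ) * (μ v / G.degree v - 1 / ∑ u, (G.degree u : ℝ)) ^ 2 := by
  set s := ∑ u, (G.degree u : ℝ) with hs
  have hcs := Finset.sum_mul_sq_le_sq_mul_sq Finset.univ (fun v => √(G.degree v : ℝ))
    (fun v => √(G.degree v : ℝ) * |μ v / G.degree v - 1 / s|)
  simp only [mul_pow, Real.sq_sqrt (Nat.cast_nonneg _), ← mul_assoc,
    Real.mul_self_sqrt (Nat.cast_nonneg _), sq_abs] at hcs
  suffices h : 2 * tvDist μ (statDist G) =
      ∑ v, (G.degree v : ℝ) * |μ v / G.degree v - 1 / s| by rwa [h]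
  rw [tvDist, mul_div_cancel₀ _ (two_ne_zero' ℝ)]
  refine Finset.sum_congr rfl fun v _ => ?_
  have hv : (0 : ℝ) < G.degree v := by exact_mod_cast hd v
  rw [statDist, ← hs, ← abs_of_pos hv, ← abs_mul, abs_of_pos hv, mul_sub,
    mul_div_cancel₀ _ hv.ne', mul_one_div]

end Graph

/-- If `G` is a finite connected graph with maximum degree `Δ` and expansion `h(G) ≥ η > 0`,
then for fixed `ε ∈ (0,1)` the mixing time of the lazy simple random walk on `G` is at most
`C · Δ² · log(|V|/ε) / η²` for a universal constant `C`: after any number `t` of steps at least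
this bound, the total variation distance to the stationary distribution is below `ε`,
regardless of the starting vertex. -/
theorem mixing_time_of_expansion :
    ∃ C : ℝ, 0 < C ∧
      ∀ (V : Type) [Fintype V] [DecidableEq V] (G : SimpleGraph V) [DecidableRel G.Adj],
        G.Connected →
        ∀ η ε : ℝ, 0 < η → η ≤ expansion G → 0 < ε → ε < 1 →
          ∀ t : ℕ,
            C * (G.maxDegree : ℝ) ^ 2 * Real.log ((Nat.card V : ℝ) / ε) / η ^ 2 ≤ (t : ℝ) →
            ∀ ξ : V,
              tvDist ((lazyStep G)^[t] (fun v => if v = ξ then (1 : ℝ) else 0)) (statDist G)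
                < ε := by
  refine ⟨8, by norm_num, ?_⟩
  intro V _ _ G _ hG η ε hη hηG hε hε1 t ht ξ
  have : Nonempty V := ⟨ξ⟩
  have hnt : Nontrivial V := by
    by_contra h
    rw [not_nontrivial_iff_subsingleton] at h
    have hcard : Nat.card V = 1 := Nat.card_eq_one_iff_unique.2 ⟨h, ⟨ξ⟩⟩
    have hzero : expansion G = 0 := by
      rw [expansion]
      convert Real.sInf_empty
      refine Set.eq_empty_iff_forall_notMem.2 ?_
      rintro _ ⟨S, hS, hS2, -⟩
      have := (Set.ncard_pos (Set.toFinite S)).2 hS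
      omega
    linarith
  have hd : ∀ x, 0 < G.degree x := fun x => hG.preconnected.degree_pos_of_nontrivial x
  set w : V → V → ℝ := fun x y => if G.Adj x y then (1 : ℝ) else 0 with hwdef
  have hdeg : ∀ x, ∑ y, w x y = G.degree x := sum_adj_eq_degree G
  set s := ∑ u, (G.degree u : ℝ) with hs
  have hdR : ∀ x, (0 : ℝ) < G.degree x := fun x => by exact_mod_cast hd x
  have hs0 : 0 < s := Finset.sum_pos (fun x _ => hdR x) Finset.univ_nonempty
  set μ₀ : V → ℝ := fun v => if v = ξ then (1 : ℝ) else 0 with hμ₀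
  set f : V → ℝ := fun v => μ₀ v / G.degree v - 1 / s with hf
  have hmean : ∑ x, (G.degree x : ℝ) * f x = 0 := by
    have h : ∀ x, (G.degree x : ℝ) * f x = μ₀ x - G.degree x / s := fun x => by
      rw [hf]
      have := (hdR x).ne'
      field_simp
    simp only [h, Finset.sum_sub_distrib, ← Finset.sum_div]
    rw [← hs, div_self hs0.ne']
    simp [hμ₀]
  have hnorm : ∑ x, (G.degree x : ℝ) * f x ^ 2 ≤ 1 := by
    have h : ∀ x, (G.degree x : ℝ) * f x ^ 2 ≤
        μ₀ x - 1 / s * ((G.degree x : ℝ) * f x) - 1 / s * μ₀ x := fun x => by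
      have hx : (1 : ℝ) ≤ G.degree x := by exact_mod_cast hd x
      by_cases hxξ : x = ξ
      · subst hxξ
        simp only [hf, hμ₀, if_true]
        have h1 : 1 / (G.degree x : ℝ) ≤ 1 := (div_le_one (by linarith)).2 hx
        have h2 : (G.degree x : ℝ) * (1 / (G.degree x : ℝ)) = 1 :=
          mul_one_div_cancel (by linarith)
        generalize 1 / (G.degree x : ℝ) = a at h1 h2
        generalize 1 / s = b
        linear_combination h1 + (a - b) * h2
      · simp only [hf, hμ₀, hxξ, if_false]
        apply le_of_eq
        ring
    refine (Finset.sum_le_sum fun x _ => h x).trans ?_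
    rw [Finset.sum_sub_distrib, Finset.sum_sub_distrib, ← Finset.mul_sum, ← Finset.mul_sum,
      hmean]
    have : 0 < 1 / s := by positivity
    simp [hμ₀]
    positivity
  have hiter : ∀ t : ℕ, (fun v => (lazyStep G)^[t] μ₀ v / G.degree v - 1 / s) =
      (lazyAverage w)^[t] f := by
    intro t
    induction t with
    | zero => rfl
    | succ t ih =>
      rw [Function.iterate_succ_apply', Function.iterate_succ_apply', lazyStep_div_degree G hd, ih]
  have hdecay := sum_sq_iterate_lazyAverage_le (w := w) (D := G.maxDegree)
    (fun x y => by simp only [w]; split_ifs <;> norm_num)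
    (fun x y => by simp only [w, G.adj_comm]) (fun x => by rw [hdeg]; exact hdR x) hη
    (fun x => by rw [hdeg]; exact_mod_cast G.degree_le_maxDegree x)
    (isoperimetry_of_le_expansion G hηG) f (by simpa only [hdeg] using hmean) t
  simp only [hdeg, ← hiter] at hdecay
  have htv := sq_two_mul_tvDist_statDist_le G hd ((lazyStep G)^[t] μ₀)
  rw [← hs] at htv
  have hD : (0 : ℝ) < G.maxDegree := (hdR ξ).trans_le (by exact_mod_cast G.degree_le_maxDegree ξ)
  have hn : (0 : ℝ) < Nat.card V := by exact_mod_cast Nat.card_pos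
  have hsn : s ≤ (Nat.card V : ℝ) ^ 2 := by
    have h : ∀ x ∈ (Finset.univ : Finset V), (G.degree x : ℝ) ≤ Nat.card V := fun x _ => by
      rw [Nat.card_eq_fintype_card]
      exact_mod_cast (G.degree_lt_card_verts x).le
    have := Finset.sum_le_card_nsmul _ _ _ h
    rwa [nsmul_eq_mul, Finset.card_univ, ← Nat.card_eq_fintype_card, ← sq] at this
  have hexp : Real.exp (-(t * (η ^ 2 / (4 * (G.maxDegree : ℝ) ^ 2)))) ≤
      (ε / Nat.card V) ^ 2 := by
    rw [← Real.exp_log (show 0 < (ε / Nat.card V) ^ 2 by positivity), Real.exp_le_exp,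
      Real.log_pow, ← inv_div (Nat.card V : ℝ) ε, Real.log_inv]
    rw [div_le_iff₀ (by positivity)] at ht
    have : 2 * Real.log (Nat.card V / ε) ≤ t * (η ^ 2 / (4 * (G.maxDegree : ℝ) ^ 2)) := by
      rw [mul_div_assoc', le_div_iff₀ (by positivity)]
      linarith
    push_cast
    linarith
  have hfinal : (2 * tvDist ((lazyStep G)^[t] μ₀) (statDist G)) ^ 2 ≤ ε ^ 2 := by
    calc _ ≤ _ := htv
      _ ≤ (Nat.card V : ℝ) ^ 2 * ((ε / Nat.card V) ^ 2 * 1) := by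
        refine mul_le_mul hsn (hdecay.trans ?_) ?_ (by positivity)
        · exact mul_le_mul hexp hnorm
            (Finset.sum_nonneg fun x _ => mul_nonneg (hdR x).le (sq_nonneg _)) (by positivity)
        · exact Finset.sum_nonneg fun x _ => mul_nonneg (hdR x).le (sq_nonneg _)
      _ = ε ^ 2 := by field_simp
  have := abs_le_of_sq_le_sq' hfinal hε.le
  linarith [this.2]
end
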